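/- The number of isomorphism classes of left braces $(B,+,\cdot)$ with additive group $(B,+)$ isomorphic to $C_2\times C_2\times C_4\times C_4$ and multiplicative group $(B,\cdot)$ isomorphic to $C_2\times C_4\times C_8$ is $25$. -/

import Mathlib

/-- A left brace structure on a set `B`: an abelian group operation `+` (with
zero element `zero` and negation `neg`), a group operation `*` (with identity
`one` and inversion `inv`), linked by the relation
`x * (y + z) = x * y - x + x * z`, i.e. `x * (y + z) = (x * y + (-x)) + x * z`. -/
structure LeftBrace (B : Type*) where
  add : B → B → B
  zero : B
  neg : B → B
  mul : B → B → B
  one : B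
  inv : B → B
  add_assoc : ∀ a b c, add (add a b) c = add a (add b c)
  add_comm : ∀ a b, add a b = add b a
  zero_add : ∀ a, add zero a = a
  neg_add_cancel : ∀ a, add (neg a) a = zero
  mul_assoc : ∀ a b c, mul (mul a b) c = mul a (mul b c)
  one_mul : ∀ a, mul one a = a
  mul_one : ∀ a, mul a one = a
  inv_mul_cancel : ∀ a, mul (inv a) a = one
  brace : ∀ x y z, mul x (add y z) = add (add (mul x y) (neg x)) (mul x z)

/-- Two left braces are isomorphic if there is a bijection preserving both
operations. -/
def LeftBrace.Iso {B₁ B₂ : Type*} (L₁ : LeftBrace B₁) (L₂ : LeftBrace B₂) : Prop :=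
  ∃ e : B₁ ≃ B₂, (∀ x y, e (L₁.add x y) = L₂.add (e x) (e y)) ∧
    (∀ x y, e (L₁.mul x y) = L₂.mul (e x) (e y))

/-- The additive group of the left brace `L` is isomorphic to the
(additively written) abelian group `A`. -/
def LeftBrace.AddIso {B : Type*} (L : LeftBrace B) (A : Type*) [AddGroup A] : Prop :=
  ∃ e : B ≃ A, ∀ x y, e (L.add x y) = e x + e y

/-- The multiplicative group of the left brace `L` is isomorphic to the
(additively written) group `A`. -/
def LeftBrace.MulIso {B : Type*} (L : LeftBrace B) (A : Type*) [AddGroup A] : Prop :=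
  ∃ e : B ≃ A, ∀ x y, e (L.mul x y) = e x + e y

namespace BrC

noncomputable section

/-! ### Codes: computations with numbers below 64 -/

/-- evaluate a number before going on -/
def frc {α : Type} (n : Nat) (k : Nat → α) : α :=
  Nat.rec (motive := fun _ => α) (k 0) (fun m _ => k (Nat.succ m)) n

/-- the `i`-th binary digit -/
def tb (n i : Nat) : Nat := Nat.land (Nat.shiftRight n i) 1

/-- addition of codes -/
def addc (m n : Nat) : Nat :=
  Nat.rec (motive := fun _ => Nat) n (fun m' _ =>
    Nat.rec (motive := fun _ => Nat) (Nat.succ m') (fun n' _ =>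
      Nat.xor (Nat.xor (Nat.succ m') (Nat.succ n'))
        (Nat.shiftRight (Nat.land (Nat.land (Nat.succ m') (Nat.succ n')) 48) 2)) n) m

def dblc (n : Nat) : Nat := Nat.shiftRight (Nat.land n 48) 2

def addIf (b : Nat) (v acc : Nat) : Nat :=
  Nat.rec (motive := fun _ => Nat) acc (fun _ _ => addc v acc) b

/-- linear combination of `e1 e2 x y` with coefficients coded by `n` -/
def lin (e1 e2 x y n : Nat) : Nat :=
  Nat.rec (motive := fun _ => Nat) 0 (fun m _ => frc (Nat.succ m) fun n =>
  addIf (tb n 0) e1 (addIf (tb n 1) e2 (addIf (tb n 2) (dblc x) (addIf (tb n 3) (dblc y)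
    (addIf (tb n 4) x (addIf (tb n 5) y 0)))))) n

/-- structure constants: the products of the generators `e1 e2 x y`, as codes -/
structure Dat where
  p11 : Nat
  p12 : Nat
  p22 : Nat
  t1 : Nat
  t2 : Nat
  s1 : Nat
  s2 : Nat
  xx : Nat
  xy : Nat
  yy : Nat

def mulc (D : Dat) (n k : Nat) : Nat :=
  frc k fun k => lin (lin D.p11 D.p12 D.t1 D.s1 k) (lin D.p12 D.p22 D.t2 D.s2 k)
    (lin D.t1 D.t2 D.xx D.xy k) (lin D.s1 D.s2 D.xy D.yy k) n

def nz (n : Nat) : Bool := not (Nat.beq n 0)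

/-- basis check -/
def bas (e1 e2 x y : Nat) : Bool :=
  Nat.beq (dblc e1) 0 && (Nat.beq (dblc e2) 0 && (nz (Nat.land e1 51) && (nz (Nat.land e2 51) &&
  (nz (Nat.land (addc e1 e2) 51) && (nz (dblc x) && (nz (dblc y) &&
    not (Nat.beq (dblc x) (dblc y))))))))

/-- change of basis check -/
def chk (D E : Dat) (e1 e2 x y : Nat) : Bool :=
  bas e1 e2 x y && (
  Nat.beq (mulc D e1 e1) (lin e1 e2 x y E.p11) && (
  Nat.beq (mulc D x e1) (lin e1 e2 x y E.t1) && (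
  Nat.beq (mulc D x y) (lin e1 e2 x y E.xy) && (
  Nat.beq (mulc D e1 e2) (lin e1 e2 x y E.p12) && (
  Nat.beq (mulc D e2 e2) (lin e1 e2 x y E.p22) && (
  Nat.beq (mulc D x e2) (lin e1 e2 x y E.t2) && (
  Nat.beq (mulc D y e1) (lin e1 e2 x y E.s1) && (
  Nat.beq (mulc D y e2) (lin e1 e2 x y E.s2) && (
  Nat.beq (mulc D x x) (lin e1 e2 x y E.xx) &&
  Nat.beq (mulc D y y) (lin e1 e2 x y E.yy))))))))))

def asc1 (D : Dat) (a b c : Nat) : Bool :=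
  Nat.beq (mulc D (mulc D a b) c) (mulc D a (mulc D b c))

def all4 (f : Nat → Bool) : Bool := f 1 && (f 2 && (f 16 && f 32))

/-- `∀ i < n` -/
def allB (n : Nat) (f : Nat → Bool) : Bool :=
  Nat.rec (motive := fun _ => Bool) true (fun i r => f i && r) n

def allL {α : Type} (l : List α) (f : α → Bool) : Bool :=
  List.rec (motive := fun _ => Bool) true (fun a _ r => f a && r) l

def repL1 : List Dat := [
  ⟨0, 0, 8, 4, 0, 8, 0, 32, 1, 4⟩,
  ⟨2, 0, 0, 0, 0, 0, 0, 32, 0, 0⟩,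
  ⟨2, 0, 0, 0, 0, 0, 0, 32, 2, 0⟩,
  ⟨2, 0, 0, 0, 0, 0, 0, 32, 8, 0⟩,
  ⟨2, 0, 0, 0, 0, 0, 0, 32, 10, 0⟩,
  ⟨2, 0, 0, 4, 0, 8, 0, 32, 0, 0⟩,
  ⟨2, 0, 0, 4, 0, 8, 0, 32, 2, 0⟩,
  ⟨2, 0, 0, 4, 0, 8, 0, 32, 8, 0⟩,
  ⟨2, 0, 0, 4, 0, 8, 0, 32, 10, 0⟩,
  ⟨2, 8, 0, 0, 0, 0, 0, 32, 0, 0⟩,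
  ⟨2, 8, 0, 0, 0, 0, 0, 32, 8, 0⟩,
  ⟨2, 8, 0, 4, 0, 8, 0, 32, 0, 0⟩,
  ⟨2, 8, 0, 4, 0, 8, 0, 32, 8, 0⟩,
  ⟨4, 8, 0, 2, 0, 0, 0, 32, 0, 0⟩,
  ⟨4, 8, 0, 2, 4, 4, 8, 32, 2, 4⟩,
  ⟨4, 8, 0, 2, 8, 8, 0, 32, 0, 0⟩,
  ⟨4, 8, 0, 2, 8, 8, 0, 32, 8, 0⟩,
  ⟨8, 0, 0, 2, 4, 4, 8, 32, 1, 2⟩,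
  ⟨8, 0, 0, 2, 4, 4, 8, 32, 3, 6⟩]

def repL2 : List Dat := [
  ⟨4, 0, 0, 2, 4, 0, 0, 1, 0, 0⟩,
  ⟨4, 0, 0, 2, 4, 0, 0, 1, 0, 4⟩,
  ⟨4, 0, 0, 2, 4, 0, 0, 1, 8, 0⟩,
  ⟨4, 0, 0, 2, 4, 0, 0, 1, 8, 4⟩,
  ⟨8, 0, 0, 2, 8, 0, 0, 1, 0, 4⟩,
  ⟨8, 0, 0, 2, 8, 0, 0, 1, 0, 12⟩]

def zD : Dat := ⟨0, 0, 0, 0, 0, 0, 0, 0, 0, 0⟩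

/-- the representatives -/
def rep (k : Nat) : Dat := cond (Nat.blt k 19) (repL1.getD k zD) (repL2.getD (Nat.sub k 19) zD)

abbrev St := List Nat

def loop : List Nat → (Nat → St → Option St) → St → Option St
  | [], _, st => some st
  | a :: l, f, st => match f a st with
    | none => none
    | some st' => loop l f st'

def guardS (b : Bool) (f : St → Option St) (st : St) : Option St := cond b (f st) (some st)

def takeC (v : Nat → Bool) : St → Option St
  | [] => none
  | c :: cs => cond (v c) (some cs) none

def rps1 : List Nat := [1, 2, 3, 32, 33, 34, 35]
def rps2 : List Nat := [1, 2, 3, 16, 17, 18, 19, 32, 33, 34, 35, 48, 49, 50, 51]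

def sol (D : Dat) (n : Nat) : Bool := Nat.beq (addc (dblc n) (mulc D n n)) 0

def cntL (l : List Nat) (f : Nat → Bool) : Nat :=
  List.rec (motive := fun _ => Nat) 0 (fun a _ r => cond (f a) (Nat.succ r) r) l

def sol2 (l : List Nat) (D : Dat) : Bool := Nat.blt (cntL l (sol D)) 2

/-- certificates for the first case -/
def vf1 (D : Dat) (c : Nat) : Bool :=
  frc (Nat.mod c 32) fun k => frc (Nat.mod (Nat.div c 32) 16) fun e1 =>
  frc (Nat.mod (Nat.div c 512) 16) fun e2 => frc (Nat.mod (Nat.div c 8192) 64) fun x =>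
  frc (mulc D x x) fun y => Nat.blt k 25 && chk D (rep k) e1 e2 x y

def vf2 (D : Dat) (c : Nat) : Bool :=
  frc (Nat.mod c 32) fun k => frc (Nat.mod (Nat.div c 32) 64) fun x =>
  frc (Nat.mod (Nat.div c 2048) 64) fun y => frc (mulc D x x) fun e1 => frc (mulc D x e1) fun e2 =>
  Nat.blt k 25 && chk D (rep k) e1 e2 x y

def dat1 (p11 p12 p22 t1 t2 u : Nat) : Dat :=
  ⟨p11, p12, p22, t1, t2, lin t1 t2 32 0 t1, lin t1 t2 32 0 t2, 32, u, lin t1 t2 32 0 u⟩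

def frcD {α : Type} (D : Dat) (k : Dat → α) : α :=
  frc D.p11 fun a => frc D.p12 fun b => frc D.p22 fun c => frc D.t1 fun d => frc D.t2 fun e =>
  frc D.s1 fun f => frc D.s2 fun g => frc D.xx fun h => frc D.xy fun i => frc D.yy fun j =>
  k ⟨a, b, c, d, e, f, g, h, i, j⟩

def ev8 : List Nat := [0, 2, 4, 6, 8, 10, 12, 14]
def ev4 : List Nat := [0, 4, 8, 12]
def ev16 : List Nat := [0, 1, 2, 3, 4, 5, 6, 7, 8, 9, 10, 11, 12, 13, 14, 15]

def okP (p11 p12 p22 : Nat) : Bool :=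
  Nat.beq (lin p12 p22 0 0 p11) (lin p11 p12 0 0 p12) &&
  Nat.beq (lin p12 p22 0 0 p12) (lin p11 p12 0 0 p22)
def okT (p11 p12 p22 t1 t2 : Nat) : Bool :=
  Nat.beq (lin p11 p12 0 0 t1) (lin t1 t2 32 0 p11) && (
  Nat.beq (lin p12 p22 0 0 t1) (lin t1 t2 32 0 p12) && (
  Nat.beq (lin p11 p12 0 0 t2) (lin t1 t2 32 0 p12) &&
  Nat.beq (lin p12 p22 0 0 t2) (lin t1 t2 32 0 p22)))
def okU (D : Dat) : Bool :=
  Nat.beq (lin D.p11 D.p12 0 0 D.xy) (lin D.t1 D.t2 32 0 D.s1) && (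
  Nat.beq (lin D.p12 D.p22 0 0 D.xy) (lin D.t1 D.t2 32 0 D.s2) && sol2 rps1 D)

def enum1 : St → Option St :=
  loop ev8 fun p11 => loop ev4 fun p12 => loop ev4 fun p22 =>
  guardS (okP p11 p12 p22) <|
  loop ev8 fun t1 => loop ev4 fun t2 =>
  guardS (okT p11 p12 p22 t1 t2) <|
  loop ev16 fun u st => frcD (dat1 p11 p12 p22 t1 t2 u) fun D =>
  guardS (okU D) (takeC (vf1 D)) st

def dat2 (w p q : Nat) : Dat :=
  ⟨w, 0, 0, 2, w, lin 2 w 0 0 p, lin 2 w 0 0 (lin 2 w 0 0 p), 1, p, q⟩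

def enum2 : St → Option St :=
  loop [4, 8] fun w => loop ev16 fun p => loop ev16 fun q st => frcD (dat2 w p q) fun D =>
  guardS (asc1 D 16 32 32 && sol2 rps2 D) (takeC (vf2 D)) st

def lt16 : List Nat := [1, 2, 3, 5, 6, 7, 9, 10, 11, 13, 14, 15]

/-- no basis of the first kind for any `E` of the list in the algebra of `D` -/
def nos1 (D : Dat) (Es : List Dat) : Bool :=
  allB 64 fun x => frc x fun x => frc (mulc D x x) fun y => Nat.beq (dblc y) 0 || (
  frc (mulc D x y) fun u => allL lt16 fun e2 => frc (mulc D x e2) fun a => frc (mulc D e2 e2) fun b =>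
    allL Es fun E =>
    not (Nat.beq a (lin 0 e2 x y E.t2) && (Nat.beq b (lin 0 e2 x y E.p22) &&
      (nz (tb E.xy 0) || Nat.beq u (lin 0 e2 x y E.xy)))) ||
    allL lt16 fun e1 => not (chk D E e1 e2 x y))

/-- no basis of the second kind for any `E` of the list in the algebra of `D` -/
def nos2 (D : Dat) (Es : List Dat) : Bool :=
  allB 64 fun x => frc x fun x => frc (mulc D x x) fun e1 => frc (mulc D x e1) fun e2 =>
    Nat.beq (Nat.land e2 51) 0 || (frc (mulc D x e2) fun w =>
    allL Es fun E => not (Nat.beq E.t2 8 || Nat.beq w (dblc x)) ||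
      allB 64 fun y => frc y fun y => not (chk D E e1 e2 x y))

def prs (f : Dat → List Dat → Bool) (l : List Dat) : Bool :=
  List.rec (motive := fun _ => Bool) true (fun a l r => f a l && r) l

/-- side conditions on the representatives -/
def sid1 (D : Dat) : Bool :=
  Nat.beq D.xx 32 && (Nat.beq (tb D.t2 0) 0 && Nat.beq (tb D.p22 0) 0)

def sid2 (D : Dat) : Bool :=
  Nat.beq D.xx 1 && (Nat.beq D.t1 2 && ((Nat.beq D.t2 4 || Nat.beq D.t2 8) &&
  allB 64 fun n => frc n fun n => Nat.beq (dblc (mulc D n n)) 0))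

def vld (D : Dat) : Bool :=
  Nat.blt D.p11 16 && (Nat.blt D.p12 16 && (Nat.blt D.p22 16 && (Nat.blt D.t1 16 && (
  Nat.blt D.t2 16 && (Nat.blt D.s1 16 && (Nat.blt D.s2 16 && (Nat.blt D.xx 64 && (
  Nat.blt D.xy 64 && Nat.blt D.yy 64))))))))

def circ (D : Dat) (n k : Nat) : Nat := addc (addc n k) (mulc D n k)

def pwc (D : Dat) (g i : Nat) : Nat :=
  Nat.rec (motive := fun _ => Nat) 0 (fun _ r => frc r fun r => circ D r g) i

/-- generators of the multiplicative group -/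
def grp (D : Dat) (g1 g2 g3 : Nat) : Bool :=
  Nat.beq (pwc D g1 2) 0 && (Nat.beq (pwc D g2 4) 0 && (Nat.beq (pwc D g3 8) 0 &&
  allB 2 fun i => frc (pwc D g1 i) fun a => allB 4 fun j => frc (circ D a (pwc D g2 j)) fun b =>
  allB 8 fun l => nz (circ D b (pwc D g3 l)) || Nat.beq (Nat.add i (Nat.add j l)) 0))

/-- codes of generators of order 2, 4, 8 -/
def gen1 (k : Nat) : Nat := [1, 4, 4, 4, 4, 4, 4, 4, 4, 4, 4, 4, 4, 2, 2, 2, 2, 4, 2, 2, 2, 2, 2, 2, 2].getD k 0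
def gen2 (k : Nat) : Nat := [2, 1, 1, 1, 1, 1, 1, 1, 1, 1, 1, 1, 1, 1, 1, 1, 1, 1, 1, 32, 32, 32, 32, 32, 32].getD k 0

def mdl (k : Nat) : Bool :=
  vld (rep k) && (grp (rep k) (gen1 k) (gen2 k) 16 &&
  all4 fun a => all4 fun b => all4 fun c => asc1 (rep k) a b c)

def certs1 : List Nat := [
  132128, 394272, 132384, 394528, 132640, 394784, 132896, 395040, 134176, 396320, 134432, 396576,
  134688, 396832, 134944, 397088, 394400, 132256, 394656, 132512, 396960, 134816, 397216, 135072,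
  396448, 134304, 396704, 134560, 394912, 132768, 395168, 133024, 132129, 132130, 132131, 132132,
  140321, 140322, 140323, 140324, 132133, 132134, 132135, 132136, 140327, 140328, 140325, 140326,
  132257, 132258, 132259, 132260, 140449, 140450, 140451, 140452, 132261, 132262, 132263, 132264,
  140455, 140456, 140453, 140454, 132137, 132138, 140330, 140329, 132139, 132140, 140331, 140332,
  132265, 132266, 140458, 140457, 132267, 132268, 140459, 140460, 132141, 142381, 132142, 136366,
  132143, 132144, 134382, 138350, 134191, 134192, 132206, 136430, 134189, 140333, 134190, 138414,
  136237, 146477, 132270, 136238, 136239, 136240, 134254, 138478, 138287, 138288, 132334, 136302,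
  138285, 144429, 134318, 138286, 134177, 134178, 134179, 134180, 142375, 142376, 142373, 142374,
  134181, 134182, 134183, 134184, 142369, 142370, 142371, 142372, 134241, 134242, 134243, 134244,
  142439, 142440, 142437, 142438, 134245, 134246, 134247, 134248, 142433, 142434, 142435, 142436,
  134185, 134186, 142379, 142380, 134187, 134188, 142378, 142377, 134249, 134250, 142443, 142444,
  134251, 134252, 142442, 142441, 131648, 393792, 131904, 394048, 393920, 131776, 394176, 132032,
  132145, 132146, 136369, 136626, 132401, 132402, 136625, 136370, 134386, 138353, 138610, 134385,
  134642, 138609, 138354, 134641, 132672, 394816, 132928, 395072, 396992, 134848, 397248, 135104,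
  132210, 132209, 136690, 136433, 132466, 132465, 136434, 136689, 134193, 138674, 138417, 134194,
  134449, 138418, 138673, 134450, 133696, 395840, 133952, 396096, 395968, 133824, 396224, 134080,
  136241, 136498, 132273, 132274, 136497, 136242, 132529, 132530, 138738, 134257, 134258, 138481,
  138482, 134513, 134514, 138737, 134720, 396864, 134976, 397120, 394944, 132800, 395200, 133056,
  136562, 136305, 132338, 132337, 136306, 136561, 132594, 132593, 138289, 134322, 134321, 138546,
  138545, 134578, 134577, 138290, 131680, 393824, 131936, 394080, 393952, 131808, 394208, 132064,
  132192, 394336, 132448, 394592, 396512, 134368, 396768, 134624, 396000, 133856, 396256, 134112,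
  133728, 395872, 133984, 396128, 394464, 132320, 394720, 132576, 134240, 396384, 134496, 396640,
  136225, 136228, 136227, 136226, 144545, 144548, 144547, 144546, 136229, 136232, 136231, 136230,
  144551, 144550, 144549, 144552, 136353, 136356, 136355, 136354, 144417, 144420, 144419, 144418,
  136357, 136360, 136359, 136358, 144423, 144422, 144421, 144424, 136233, 136234, 144554, 144553,
  136235, 136236, 144555, 144556, 136361, 136362, 144426, 144425, 136363, 136364, 144427, 144428,
  394285, 408621, 394478, 398446, 398383, 398384, 396462, 400430, 400431, 400432, 394414, 398382,
  396333, 406573, 396398, 400622, 398381, 404525, 394350, 398574, 394287, 394288, 396334, 400558,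
  396335, 396336, 394286, 398510, 400429, 402477, 396526, 400494, 138273, 138276, 138275, 138274,
  146535, 146534, 146533, 146536, 138277, 138280, 138279, 138278, 146529, 146532, 146531, 146530,
  138337, 138340, 138339, 138338, 146471, 146470, 146469, 146472, 138341, 138344, 138343, 138342,
  146465, 146468, 146467, 146466, 138281, 138282, 146539, 146540, 138283, 138284, 146538, 146537,
  138345, 138346, 146475, 146476, 138347, 138348, 146474, 146473]

def certs2 : List Nat := [
  66067, 66068, 98835, 98836, 68116, 68115, 100884, 100883, 70163, 70164, 102931, 102932, 72212,
  72211, 104980, 104979, 66069, 66070, 102933, 102934, 68118, 68117, 104982, 104981, 70165,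
  70166, 98837, 98838, 72214, 72213, 100886, 100885, 66071, 66072, 99347, 103444, 68120, 68119,
  105492, 101395, 67096, 71191, 103445, 99350, 73239, 69144, 101398, 105493, 70167, 70168,
  103443, 99348, 72216, 72215, 101396, 105491, 71192, 67095, 99349, 103446, 69143, 73240, 105494,
  101397]

set_option maxRecDepth 100000 in
theorem k_enum1 : (enum1 certs1).isSome = true := by decide +kernel
set_option maxRecDepth 100000 in
theorem k_enum2 : (enum2 certs2).isSome = true := by decide +kernel
set_option maxRecDepth 100000 in
theorem k_nos1 : prs nos1 repL1 = true := by decide +kernel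
set_option maxRecDepth 100000 in
theorem k_nos2 : prs nos2 repL2 = true := by decide +kernel
theorem k_sid1 : allL repL1 sid1 = true := by decide +kernel
theorem k_sid2 : allL repL2 sid2 = true := by decide +kernel
set_option maxRecDepth 100000 in
theorem k_mdl : (allB 25 fun k => frc k fun k => mdl k) = true := by decide +kernel

end

end BrC
namespace BrC

/-! ### Bases of the additive group -/

abbrev A := ZMod 2 × ZMod 2 × ZMod 4 × ZMod 4

def cx (n : Nat) : Nat := tb n 4 + 2 * tb n 2
def cy (n : Nat) : Nat := tb n 5 + 2 * tb n 3

def ev (e1 e2 x y : A) (n : Nat) : A := tb n 0 • e1 + tb n 1 • e2 + cx n • x + cy n • y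

theorem tb_le (n i : Nat) : tb n i = 0 ∨ tb n i = 1 := by
  have : tb n i = (n >>> i) % 2 := by
    show (n >>> i) &&& 1 = _
    exact Nat.and_one_is_mod _
  omega

set_option maxRecDepth 100000 in
theorem addc_spec : ∀ m < 64, ∀ n < 64, tb (addc m n) 0 = (tb m 0 + tb n 0) % 2 ∧
    tb (addc m n) 1 = (tb m 1 + tb n 1) % 2 ∧ cx (addc m n) = (cx m + cx n) % 4 ∧
    cy (addc m n) = (cy m + cy n) % 4 ∧ addc m n < 64 := by decide +kernel

set_option maxRecDepth 100000 in
theorem addc_self_zero : ∀ m < 64, ∀ n < 64, addc m (addc n (addc n n)) = 0 → m = n := by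
  decide +kernel

set_option maxRecDepth 100000 in
theorem dblc_eq : ∀ m < 64, dblc m = addc m m := by decide +kernel

theorem dblc_bd : ∀ m < 64, dblc m < 64 := by decide +kernel

theorem addc_lt {m n : Nat} (hm : m < 64) (hn : n < 64) : addc m n < 64 :=
  (addc_spec m hm n hn).2.2.2.2

theorem four (a : A) : a + a + (a + a) = 0 := by
  revert a; decide +kernel

theorem mod2 {e : A} (h : e + e = 0) (k : Nat) : (k % 2) • e = k • e := by
  conv_rhs => rw [← Nat.mod_add_div k 2, add_smul, mul_smul, smul_comm]
  rw [two_smul, h, smul_zero, add_zero] 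
theorem mod4 (e : A) (k : Nat) : (k % 4) • e = k • e := by
  conv_rhs => rw [← Nat.mod_add_div k 4, add_smul, mul_smul, smul_comm]
  have : (4:ℕ) • e = 0 := by have := four e; rw [← this]; abel
  rw [this, smul_zero, add_zero]

theorem ev_zero (e1 e2 x y : A) : ev e1 e2 x y 0 = 0 := by
  simp [ev, show tb 0 0 = 0 by decide, show tb 0 1 = 0 by decide, show cx 0 = 0 by decide,
    show cy 0 = 0 by decide]

theorem ev_addc {e1 e2 : A} (h1 : e1 + e1 = 0) (h2 : e2 + e2 = 0) (x y : A) {m n : Nat}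
    (hm : m < 64) (hn : n < 64) :
    ev e1 e2 x y (addc m n) = ev e1 e2 x y m + ev e1 e2 x y n := by
  obtain ⟨a, b, c, d, -⟩ := addc_spec m hm n hn
  unfold ev
  rw [a, b, c, d, mod2 h1, mod2 h2, mod4, mod4]
  simp only [add_smul]; abel

theorem ev_dblc {e1 e2 : A} (h1 : e1 + e1 = 0) (h2 : e2 + e2 = 0) (x y : A) {m : Nat}
    (hm : m < 64) :
    ev e1 e2 x y (dblc m) = ev e1 e2 x y m + ev e1 e2 x y m := by
  rw [dblc_eq m hm, ev_addc h1 h2 x y hm hm]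

theorem frc_eq {α : Type} (n : Nat) (k : Nat → α) : frc n k = k n := by cases n <;> rfl

theorem lin_eq (e1 e2 x y n : Nat) : lin e1 e2 x y n =
  addIf (tb n 0) e1 (addIf (tb n 1) e2 (addIf (tb n 2) (dblc x) (addIf (tb n 3) (dblc y)
    (addIf (tb n 4) x (addIf (tb n 5) y 0))))) := by
  cases n with
  | zero => rfl
  | succ n => exact frc_eq (n + 1) (fun n => addIf (tb n 0) e1 (addIf (tb n 1) e2 (addIf (tb n 2) (dblc x)
      (addIf (tb n 3) (dblc y) (addIf (tb n 4) x (addIf (tb n 5) y 0))))))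

theorem addIf_lt {b v acc : Nat} (hv : v < 64) (ha : acc < 64) : addIf b v acc < 64 := by
  cases b with
  | zero => exact ha
  | succ b => exact addc_lt hv ha

theorem lin_lt {e1 e2 x y : Nat} (h1 : e1 < 64) (h2 : e2 < 64) (hx : x < 64) (hy : y < 64) (n : Nat) :
    lin e1 e2 x y n < 64 := by
  rw [lin_eq]
  exact addIf_lt h1 (addIf_lt h2 (addIf_lt (dblc_bd _ hx) (addIf_lt (dblc_bd _ hy) (addIf_lt hx
    (addIf_lt hy (by norm_num))))))

theorem ev_addIf {e1 e2 : A} (h1 : e1 + e1 = 0) (h2 : e2 + e2 = 0) (x y : A) {v acc : Nat} (n i : Nat)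
    (hv : v < 64) (ha : acc < 64) :
    ev e1 e2 x y (addIf (tb n i) v acc) = tb n i • ev e1 e2 x y v + ev e1 e2 x y acc := by
  rcases tb_le n i with h | h <;> rw [h]
  · simp [addIf]
  · rw [one_smul]; exact ev_addc h1 h2 x y hv ha

theorem ev_lin {e1 e2 : A} (h1 : e1 + e1 = 0) (h2 : e2 + e2 = 0) (x y : A) {n1 n2 nx ny : Nat}
    (l1 : n1 < 64) (l2 : n2 < 64) (lx : nx < 64) (ly : ny < 64) (c : Nat) :
    ev e1 e2 x y (lin n1 n2 nx ny c) =
      ev (ev e1 e2 x y n1) (ev e1 e2 x y n2) (ev e1 e2 x y nx) (ev e1 e2 x y ny) c := by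
  have b1 : addIf (tb c 5) ny 0 < 64 := addIf_lt ly (by norm_num)
  have b2 := addIf_lt (b := tb c 4) lx b1
  have b3 := addIf_lt (b := tb c 3) (dblc_bd _ ly) b2
  have b4 := addIf_lt (b := tb c 2) (dblc_bd _ lx) b3
  have b5 := addIf_lt (b := tb c 1) l2 b4
  rw [lin_eq, ev_addIf h1 h2 x y _ _ l1 b5, ev_addIf h1 h2 x y _ _ l2 b4,
    ev_addIf h1 h2 x y _ _ (dblc_bd _ lx) b3, ev_addIf h1 h2 x y _ _ (dblc_bd _ ly) b2,
    ev_addIf h1 h2 x y _ _ lx b1, ev_addIf h1 h2 x y _ _ ly (by norm_num), ev_zero,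
    ev_dblc h1 h2 x y lx, ev_dblc h1 h2 x y ly]
  generalize ev e1 e2 x y n1 = a
  generalize ev e1 e2 x y n2 = b
  generalize ev e1 e2 x y nx = c'
  generalize ev e1 e2 x y ny = d
  unfold ev cx cy
  module

theorem map_ev (f : A → A) (hf : ∀ a b, f (a + b) = f a + f b) (e1 e2 x y : A) (n : Nat) :
    f (ev e1 e2 x y n) = ev (f e1) (f e2) (f x) (f y) n := by
  let g : A →+ A := AddMonoidHom.mk' f hf
  show g _ = ev (g e1) (g e2) (g x) (g y) n
  simp only [ev, map_add, map_nsmul]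

structure Bil where
  m : A → A → A
  comm : ∀ a b, m a b = m b a
  add : ∀ a b c, m a (b + c) = m a b + m a c

theorem Bil.add' (N : Bil) (a b c : A) : N.m (a + b) c = N.m a c + N.m b c := by
  rw [N.comm, N.add, N.comm c, N.comm c]

theorem Bil.zero (N : Bil) (a : A) : N.m a 0 = 0 := by
  have := N.add a 0 0
  rw [add_zero] at this
  exact (add_eq_left.mp this.symm)

theorem Bil.zero' (N : Bil) (a : A) : N.m 0 a = 0 := by rw [N.comm, N.zero]

def InW (a : A) : Prop := ∃ b, a = b + b

structure Bas (e1 e2 x y : A) : Prop where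
  d1 : e1 + e1 = 0
  d2 : e2 + e2 = 0
  w1 : ¬ InW e1
  w2 : ¬ InW e2
  w12 : ¬ InW (e1 + e2)
  dx : x + x ≠ 0
  dy : y + y ≠ 0
  dxy : x + x ≠ y + y

structure Vl (D : Dat) : Prop where
  p11 : D.p11 < 64
  p12 : D.p12 < 64
  p22 : D.p22 < 64
  t1 : D.t1 < 64
  t2 : D.t2 < 64
  s1 : D.s1 < 64
  s2 : D.s2 < 64
  xx : D.xx < 64
  xy : D.xy < 64
  yy : D.yy < 64

structure Sys (m : A → A → A) (D : Dat) (e1 e2 x y : A) : Prop where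
  B : Bas e1 e2 x y
  vl : Vl D
  p11 : m e1 e1 = ev e1 e2 x y D.p11
  p12 : m e1 e2 = ev e1 e2 x y D.p12
  p22 : m e2 e2 = ev e1 e2 x y D.p22
  t1 : m x e1 = ev e1 e2 x y D.t1
  t2 : m x e2 = ev e1 e2 x y D.t2
  s1 : m y e1 = ev e1 e2 x y D.s1
  s2 : m y e2 = ev e1 e2 x y D.s2
  xx : m x x = ev e1 e2 x y D.xx
  xy : m x y = ev e1 e2 x y D.xy
  yy : m y y = ev e1 e2 x y D.yy

theorem InW.add {a b : A} : InW a → InW b → InW (a + b) := by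
  rintro ⟨c, rfl⟩ ⟨d, rfl⟩; exact ⟨c + d, by abel⟩
theorem InW.zero : InW 0 := ⟨0, by simp⟩
theorem InW.dbl {a : A} (h : InW a) : a + a = 0 := by
  obtain ⟨c, rfl⟩ := h; exact four c
theorem InW.neg {a : A} (h : InW a) : InW (-a) := by
  obtain ⟨c, rfl⟩ := h; exact ⟨-c, by abel⟩

theorem bits_cases : ∀ n < 64, n = tb n 0 + 2 * tb n 1 + 4 * tb n 2 + 8 * tb n 3 + 16 * tb n 4 + 32 * tb n 5 := by
  decide +kernel

theorem ev_eq_zero {e1 e2 x y : A} (B : Bas e1 e2 x y) {n : Nat} (hn : n < 64)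
    (h : ev e1 e2 x y n = 0) : n = 0 := by
  have hb := bits_cases n hn
  unfold ev cx cy at h
  have key : tb n 4 • (x + x) + tb n 5 • (y + y) = 0 := by
    have e : (tb n 0 • e1 + tb n 1 • e2 + (tb n 4 + 2 * tb n 2) • x + (tb n 5 + 2 * tb n 3) • y) + (tb n 0 • e1 + tb n 1 • e2 + (tb n 4 + 2 * tb n 2) • x + (tb n 5 + 2 * tb n 3) • y)
      = tb n 0 • (e1 + e1) + tb n 1 • (e2 + e2) + tb n 2 • (x + x + (x + x)) + tb n 3 • (y + y + (y + y)) + (tb n 4 • (x + x) + tb n 5 • (y + y)) := by module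
    rw [h, B.d1, B.d2, four, four] at e
    simpa using e.symm
  have h45 : tb n 4 = 0 ∧ tb n 5 = 0 := by
    rcases tb_le n 4 with h4 | h4 <;> rcases tb_le n 5 with h5 | h5 <;> rw [h4, h5] at key <;>
      simp only [zero_smul, one_smul, zero_add, add_zero] at key
    · exact ⟨h4, h5⟩
    · exact absurd key B.dy
    · exact absurd key B.dx
    · refine absurd ?_ B.dxy
      have := four y
      rw [← this] at key; exact add_right_cancel key
  obtain ⟨h4, h5⟩ := h45
  rw [h4, h5] at h hb
  have hw : InW (tb n 0 • e1 + tb n 1 • e2) := by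
    have : tb n 0 • e1 + tb n 1 • e2 = - ((0 + 2 * tb n 2) • x + (0 + 2 * tb n 3) • y) := by
      rw [← add_eq_zero_iff_eq_neg, ← h]; abel
    rw [this]
    apply InW.neg
    exact ⟨tb n 2 • x + tb n 3 • y, by module⟩
  have h01 : tb n 0 = 0 ∧ tb n 1 = 0 := by
    rcases tb_le n 0 with h4 | h4 <;> rcases tb_le n 1 with h5 | h5 <;> rw [h4, h5] at hw <;>
      simp only [zero_smul, one_smul, zero_add, add_zero] at hw
    · exact ⟨h4, h5⟩
    · exact absurd hw B.w2
    · exact absurd hw B.w1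
    · exact absurd hw B.w12
  obtain ⟨h0, h1⟩ := h01
  rw [h0, h1] at h hb
  have key2 : tb n 2 • (x + x) + tb n 3 • (y + y) = 0 := by rw [← h]; module
  rcases tb_le n 2 with h4 | h4 <;> rcases tb_le n 3 with h5 | h5 <;> rw [h4, h5] at key2 <;>
      simp only [zero_smul, one_smul, zero_add, add_zero] at key2
  · rw [hb, h4, h5]
  · exact absurd key2 B.dy
  · exact absurd key2 B.dx
  · refine absurd ?_ B.dxy
    have := four y
    rw [← this] at key2; exact add_right_cancel key2

theorem ev_inj {e1 e2 x y : A} (B : Bas e1 e2 x y) {n k : Nat} (hn : n < 64) (hk : k < 64)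
    (h : ev e1 e2 x y n = ev e1 e2 x y k) : n = k := by
  apply addc_self_zero n hn k hk
  have b1 := addc_lt hk hk
  have b2 := addc_lt hk b1
  apply ev_eq_zero B (addc_lt hn b2)
  rw [ev_addc B.d1 B.d2 x y hn b2, ev_addc B.d1 B.d2 x y hk b1, ev_addc B.d1 B.d2 x y hk hk, h]
  rw [← four (ev e1 e2 x y k)]; abel

theorem ev_bij {e1 e2 x y : A} (B : Bas e1 e2 x y) :
    Function.Bijective (fun n : Fin 64 => ev e1 e2 x y n.1) := by
  rw [Fintype.bijective_iff_injective_and_card]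
  refine ⟨fun a b h => Fin.ext (ev_inj B a.2 b.2 h), by simp [ZMod.card]⟩

theorem ev_surj {e1 e2 x y : A} (B : Bas e1 e2 x y) (a : A) : ∃ n < 64, a = ev e1 e2 x y n := by
  obtain ⟨n, hn⟩ := (ev_bij B).2 a
  exact ⟨n.1, n.2, hn.symm⟩

theorem dblc_land : ∀ k < 64, Nat.land (dblc k) 51 = 0 := by decide +kernel
theorem land_cases : ∀ n < 64, Nat.land n 51 = 0 → n = 0 ∨ n = 4 ∨ n = 8 ∨ n = 12 := by decide +kernel

theorem ev_4 (e1 e2 x y : A) : ev e1 e2 x y 4 = x + x := by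
  unfold ev cx cy
  rw [show tb 4 0 = 0 by decide, show tb 4 1 = 0 by decide, show tb 4 2 = 1 by decide, show tb 4 3 = 0 by decide, show tb 4 4 = 0 by decide, show tb 4 5 = 0 by decide]
  module
theorem ev_8 (e1 e2 x y : A) : ev e1 e2 x y 8 = y + y := by
  unfold ev cx cy
  rw [show tb 8 0 = 0 by decide, show tb 8 1 = 0 by decide, show tb 8 2 = 0 by decide, show tb 8 3 = 1 by decide, show tb 8 4 = 0 by decide, show tb 8 5 = 0 by decide]
  module
theorem ev_12 (e1 e2 x y : A) : ev e1 e2 x y 12 = x + x + (y + y) := by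
  unfold ev cx cy
  rw [show tb 12 0 = 0 by decide, show tb 12 1 = 0 by decide, show tb 12 2 = 1 by decide, show tb 12 3 = 1 by decide, show tb 12 4 = 0 by decide, show tb 12 5 = 0 by decide]
  module
theorem ev_1 (e1 e2 x y : A) : ev e1 e2 x y 1 = e1 := by
  unfold ev cx cy
  rw [show tb 1 0 = 1 by decide, show tb 1 1 = 0 by decide, show tb 1 2 = 0 by decide, show tb 1 3 = 0 by decide, show tb 1 4 = 0 by decide, show tb 1 5 = 0 by decide]
  module
theorem ev_2 (e1 e2 x y : A) : ev e1 e2 x y 2 = e2 := by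
  unfold ev cx cy
  rw [show tb 2 0 = 0 by decide, show tb 2 1 = 1 by decide, show tb 2 2 = 0 by decide, show tb 2 3 = 0 by decide, show tb 2 4 = 0 by decide, show tb 2 5 = 0 by decide]
  module
theorem ev_16 (e1 e2 x y : A) : ev e1 e2 x y 16 = x := by
  unfold ev cx cy
  rw [show tb 16 0 = 0 by decide, show tb 16 1 = 0 by decide, show tb 16 2 = 0 by decide, show tb 16 3 = 0 by decide, show tb 16 4 = 1 by decide, show tb 16 5 = 0 by decide]
  module
theorem ev_32 (e1 e2 x y : A) : ev e1 e2 x y 32 = y := by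
  unfold ev cx cy
  rw [show tb 32 0 = 0 by decide, show tb 32 1 = 0 by decide, show tb 32 2 = 0 by decide, show tb 32 3 = 0 by decide, show tb 32 4 = 0 by decide, show tb 32 5 = 1 by decide]
  module

theorem W_cases {e1 e2 x y : A} (B : Bas e1 e2 x y) {t : A} (h : InW t) :
    t = 0 ∨ t = x + x ∨ t = y + y ∨ t = x + x + (y + y) := by
  obtain ⟨b, rfl⟩ := h
  obtain ⟨k, hk, rfl⟩ := ev_surj B b
  rw [← ev_dblc B.d1 B.d2 x y hk]
  rcases land_cases _ (dblc_bd k hk) (dblc_land k hk) with h | h | h | h <;> rw [h]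
  · left; exact ev_zero _ _ _ _
  · right; left; exact ev_4 _ _ _ _
  · right; right; left; exact ev_8 _ _ _ _
  · right; right; right; exact ev_12 _ _ _ _

theorem InW_ev {e1 e2 x y : A} (B : Bas e1 e2 x y) {n : Nat} (hn : n < 64) :
    InW (ev e1 e2 x y n) ↔ Nat.land n 51 = 0 := by
  constructor
  · rintro ⟨b, hb⟩
    obtain ⟨k, hk, rfl⟩ := ev_surj B b
    rw [← ev_dblc B.d1 B.d2 x y hk] at hb
    rw [ev_inj B hn (dblc_bd k hk) hb]
    exact dblc_land k hk
  · intro h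
    rcases land_cases n hn h with h | h | h | h <;> rw [h]
    · rw [ev_zero]; exact InW.zero
    · rw [ev_4]; exact ⟨x, rfl⟩
    · rw [ev_8]; exact ⟨y, rfl⟩
    · rw [ev_12]; exact ⟨x + y, by abel⟩

theorem dbl_ev {e1 e2 x y : A} (B : Bas e1 e2 x y) {n : Nat} (hn : n < 64) :
    ev e1 e2 x y n + ev e1 e2 x y n = 0 ↔ dblc n = 0 := by
  rw [← ev_dblc B.d1 B.d2 x y hn]
  exact ⟨ev_eq_zero B (dblc_bd n hn), fun h => by rw [h, ev_zero]⟩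

theorem V_code : ∀ n < 64, dblc n = 0 → n < 16 ∧ (Nat.land n 51 = 0 ∨ Nat.land (addc n 1) 51 = 0 ∨
    Nat.land (addc n 2) 51 = 0 ∨ Nat.land (addc (addc n 1) 2) 51 = 0) := by decide +kernel

theorem V_cases {e1 e2 x y : A} (B : Bas e1 e2 x y) {t : A} (h : t + t = 0) :
    InW t ∨ InW (t + e1) ∨ InW (t + e2) ∨ InW (t + e1 + e2) := by
  obtain ⟨k, hk, rfl⟩ := ev_surj B t
  rw [dbl_ev B hk] at h
  have h1 := ev_addc B.d1 B.d2 x y hk (show 1 < 64 by norm_num)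
  have h2 := ev_addc B.d1 B.d2 x y hk (show 2 < 64 by norm_num)
  have b := addc_lt hk (show 1 < 64 by norm_num)
  have h3 := ev_addc B.d1 B.d2 x y b (show 2 < 64 by norm_num)
  rw [ev_1] at h1
  rw [ev_2] at h2
  rw [ev_2, h1] at h3
  rw [← h3, ← h1, ← h2]
  rw [InW_ev B hk, InW_ev B b, InW_ev B (addc_lt hk (by norm_num)), InW_ev B (addc_lt b (by norm_num))]
  exact (V_code k hk h).2

theorem mulc_eq (D : Dat) (n k : Nat) : mulc D n k =
    lin (lin D.p11 D.p12 D.t1 D.s1 k) (lin D.p12 D.p22 D.t2 D.s2 k)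
    (lin D.t1 D.t2 D.xx D.xy k) (lin D.s1 D.s2 D.xy D.yy k) n := frc_eq _ _

theorem mulc_lt {D : Dat} (v : Vl D) (n k : Nat) : mulc D n k < 64 := by
  rw [mulc_eq]
  exact lin_lt (lin_lt v.p11 v.p12 v.t1 v.s1 _) (lin_lt v.p12 v.p22 v.t2 v.s2 _)
    (lin_lt v.t1 v.t2 v.xx v.xy _) (lin_lt v.s1 v.s2 v.xy v.yy _) _

theorem mul_ev {N : Bil} {D : Dat} {e1 e2 x y : A} (S : Sys N.m D e1 e2 x y) (n k : Nat) :
    N.m (ev e1 e2 x y n) (ev e1 e2 x y k) = ev e1 e2 x y (mulc D n k) := by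
  have v := S.vl
  have d1 := S.B.d1
  have d2 := S.B.d2
  rw [mulc_eq, ev_lin d1 d2 x y (lin_lt v.p11 v.p12 v.t1 v.s1 _) (lin_lt v.p12 v.p22 v.t2 v.s2 _)
    (lin_lt v.t1 v.t2 v.xx v.xy _) (lin_lt v.s1 v.s2 v.xy v.yy _) _,
    ev_lin d1 d2 x y v.p11 v.p12 v.t1 v.s1 _, ev_lin d1 d2 x y v.p12 v.p22 v.t2 v.s2 _,
    ev_lin d1 d2 x y v.t1 v.t2 v.xx v.xy _, ev_lin d1 d2 x y v.s1 v.s2 v.xy v.yy _]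
  rw [← S.p11, ← S.p12, ← S.p22, ← S.t1, ← S.t2, ← S.s1, ← S.s2, ← S.xx, ← S.xy, ← S.yy]
  rw [map_ev (fun a => N.m a (ev e1 e2 x y k)) (fun a b => N.add' a b _)]
  beta_reduce
  rw [map_ev (N.m e1) (N.add e1), map_ev (N.m e2) (N.add e2), map_ev (N.m x) (N.add x),
    map_ev (N.m y) (N.add y), N.comm e2 e1, N.comm e1 x, N.comm e1 y, N.comm e2 x, N.comm e2 y,
    N.comm y x]

theorem nz_iff (n : Nat) : nz n = true ↔ n ≠ 0 := by
  unfold nz; rw [Bool.not_eq_true', ← Bool.not_eq_true, Nat.beq_eq]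

theorem bas_iff {e1 e2 x y : A} (B : Bas e1 e2 x y) {n1 n2 nx ny : Nat}
    (l1 : n1 < 64) (l2 : n2 < 64) (lx : nx < 64) (ly : ny < 64) :
    Bas (ev e1 e2 x y n1) (ev e1 e2 x y n2) (ev e1 e2 x y nx) (ev e1 e2 x y ny) ↔
      bas n1 n2 nx ny = true := by
  unfold bas
  simp only [Bool.and_eq_true, Nat.beq_eq, nz_iff, Bool.not_eq_true', ← Bool.not_eq_true, ne_eq]
  rw [← dbl_ev B l1, ← dbl_ev B l2, ← InW_ev B l1, ← InW_ev B l2, ← InW_ev B (addc_lt l1 l2),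
    ev_addc B.d1 B.d2 x y l1 l2, ← dbl_ev B lx, ← dbl_ev B ly]
  have : dblc nx = dblc ny ↔ ev e1 e2 x y nx + ev e1 e2 x y nx = ev e1 e2 x y ny + ev e1 e2 x y ny := by
    rw [← ev_dblc B.d1 B.d2 x y lx, ← ev_dblc B.d1 B.d2 x y ly]
    exact ⟨fun h => by rw [h], ev_inj B (dblc_bd _ lx) (dblc_bd _ ly)⟩
  rw [this]
  exact ⟨fun ⟨a, b, c, d, e, f, g, h⟩ => ⟨a, b, c, d, e, f, g, h⟩,
    fun ⟨a, b, c, d, e, f, g, h⟩ => ⟨a, b, c, d, e, f, g, h⟩⟩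

theorem chk_iff {N : Bil} {D E : Dat} {e1 e2 x y : A} (S : Sys N.m D e1 e2 x y) (vE : Vl E)
    {n1 n2 nx ny : Nat} (l1 : n1 < 64) (l2 : n2 < 64) (lx : nx < 64) (ly : ny < 64) :
    Sys N.m E (ev e1 e2 x y n1) (ev e1 e2 x y n2) (ev e1 e2 x y nx) (ev e1 e2 x y ny) ↔
      chk D E n1 n2 nx ny = true := by
  have key : ∀ a b c, (mulc D a b = lin n1 n2 nx ny c ↔ N.m (ev e1 e2 x y a) (ev e1 e2 x y b) =
      ev (ev e1 e2 x y n1) (ev e1 e2 x y n2) (ev e1 e2 x y nx) (ev e1 e2 x y ny) c) := by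
    intro a b c
    rw [mul_ev S, ← ev_lin S.B.d1 S.B.d2 x y l1 l2 lx ly]
    exact ⟨fun h => by rw [h], ev_inj S.B (mulc_lt S.vl _ _) (lin_lt l1 l2 lx ly _)⟩
  unfold chk
  simp only [Bool.and_eq_true, Nat.beq_eq, key]
  rw [← bas_iff S.B l1 l2 lx ly]
  exact ⟨fun ⟨a0, _, a1, a2, a3, a4, a5, a6, a7, a8, a9, a10⟩ => ⟨a0, a1, a4, a9, a2, a3, a5, a6, a7, a8, a10⟩,
    fun ⟨a0, a1, a4, a9, a2, a3, a5, a6, a7, a8, a10⟩ => ⟨a0, vE, a1, a2, a3, a4, a5, a6, a7, a8, a9, a10⟩⟩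

end BrC
namespace BrC

/-! ### From braces to commutative radical rings -/

structure NR extends Bil where
  assoc : ∀ a b c, m (m a b) c = m a (m b c)
  quasi : ∀ c, ∃ c', c + c' + m c c' = 0

def Rp (L : LeftBrace (Fin 64)) (N : NR) : Prop :=
  ∃ e : Fin 64 ≃ A, (∀ a b, e (L.add a b) = e a + e b) ∧
    ∀ a b, e (L.mul a b) = e a + e b + N.m (e a) (e b)

structure Good (N : NR) : Prop where
  cnt : Nat.card {a : A // a + a + N.m a a = 0} = 8
  ex : ∃ x b, b = x + x + N.m x x ∧ b + b + N.m b b ≠ 0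

theorem exists_NR (L : LeftBrace (Fin 64)) (h1 : L.AddIso A)
    (h2 : L.MulIso (ZMod 2 × ZMod 4 × ZMod 8)) : ∃ N : NR, Rp L N ∧ Good N := by
  obtain ⟨e, he⟩ := h1
  obtain ⟨f, hf⟩ := h2
  have mcomm : ∀ a b, L.mul a b = L.mul b a := by
    intro a b; apply f.injective; rw [hf, hf, add_comm]
  have ez : e L.zero = 0 := by
    have := he L.zero L.zero
    rw [L.zero_add] at this
    exact add_eq_left.mp this.symm
  have en : ∀ a, e (L.neg a) = - e a := by
    intro a
    have := he (L.neg a) a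
    rw [L.neg_add_cancel, ez] at this
    exact eq_neg_of_add_eq_zero_left this.symm
  let m : A → A → A := fun a b => e (L.mul (e.symm a) (e.symm b)) - a - b
  have hm : ∀ a b, e (L.mul a b) = e a + e b + m (e a) (e b) := by
    intro a b
    show _ = e a + e b + (e (L.mul (e.symm (e a)) (e.symm (e b))) - e a - e b)
    rw [e.symm_apply_apply, e.symm_apply_apply]; abel
  have comm : ∀ a b, m a b = m b a := by
    intro a b
    show e (L.mul (e.symm a) (e.symm b)) - a - b = e (L.mul (e.symm b) (e.symm a)) - b - a
    rw [mcomm]; abel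
  have add : ∀ a b c, m a (b + c) = m a b + m a c := by
    intro a b c
    have hs : e.symm (b + c) = L.add (e.symm b) (e.symm c) := by
      apply e.injective; rw [he]; simp
    show e (L.mul (e.symm a) (e.symm (b + c))) - a - (b + c) =
      (e (L.mul (e.symm a) (e.symm b)) - a - b) + (e (L.mul (e.symm a) (e.symm c)) - a - c)
    rw [hs, L.brace, he, he, en, e.apply_symm_apply]
    abel
  let Bm : Bil := ⟨m, comm, add⟩
  have e1 : e L.one = 0 := by
    have := hm L.one L.zero
    rw [L.one_mul, ez, show m (e L.one) 0 = 0 from Bm.zero _] at this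
    simpa using this.symm
  have assoc : ∀ a b c, m (m a b) c = m a (m b c) := by
    intro a b c
    have := L.mul_assoc (e.symm a) (e.symm b) (e.symm c)
    have h := congrArg e this
    rw [hm, hm, hm, hm] at h
    simp only [e.apply_symm_apply] at h
    have k1 : m (a + b + m a b) c = m a c + m b c + m (m a b) c := by
      rw [show ∀ a b c, m (a + b) c = m a c + m b c from Bm.add', show ∀ a b c, m (a + b) c = m a c + m b c from Bm.add']
    rw [k1, add, add] at h
    have h' : m (m a b) c + (a + b + c + m a b + m a c + m b c) = m a (m b c) + (a + b + c + m a b + m a c + m b c) := by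
      calc _ = a + b + m a b + c + (m a c + m b c + m (m a b) c) := by abel
        _ = _ := h
        _ = _ := by abel
    exact add_right_cancel h'
  have quasi : ∀ c, ∃ c', c + c' + m c c' = 0 := by
    intro c
    refine ⟨e (L.inv (e.symm c)), ?_⟩
    have h := hm (e.symm c) (L.inv (e.symm c))
    rw [mcomm, L.inv_mul_cancel, e1, e.apply_symm_apply] at h
    exact h.symm
  have fone : f L.one = 0 := by
    have := hf L.one L.one
    rw [L.one_mul] at this
    exact add_eq_left.mp this.symm
  have hz : ∀ b, e b = 0 ↔ f b = 0 := by
    intro b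
    rw [← e1, ← fone, e.apply_eq_iff_eq, f.apply_eq_iff_eq]
  refine ⟨⟨⟨m, comm, add⟩, assoc, quasi⟩, ⟨e, he, hm⟩, ?_, ?_⟩
  · have : Nat.card {a : A // a + a + m a a = 0} = Nat.card {g : ZMod 2 × ZMod 4 × ZMod 8 // g + g = 0} := by
      apply Nat.card_congr
      refine (e.symm.trans f).subtypeEquiv ?_
      intro a
      show _ ↔ f (e.symm a) + f (e.symm a) = 0
      rw [← hf, ← hz, hm, e.apply_symm_apply]
    refine Eq.trans this ?_
    rw [Nat.card_eq_fintype_card]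
    decide +kernel
  · let b := f.symm (0, 0, 1)
    refine ⟨e b, e (L.mul b b), hm b b, ?_⟩
    show e (L.mul b b) + e (L.mul b b) + m (e (L.mul b b)) (e (L.mul b b)) ≠ 0
    rw [← hm, ne_eq, hz, hf, hf, f.apply_symm_apply]
    decide +kernel

theorem NR.quasi0 (N : NR) {c v : A} (h : v + N.m c v = 0) : v = 0 := by
  obtain ⟨c', hc⟩ := N.quasi c
  have : N.m (c + c' + N.m c c') v = 0 := by rw [hc, N.zero']
  rw [N.add', N.add', N.comm c c', N.assoc] at this
  have h2 : N.m c' (v + N.m c v) = 0 := by rw [h, N.zero]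
  rw [N.add] at h2
  calc v = v + (N.m c v + N.m c' v + N.m c' (N.m c v)) := by rw [this, add_zero]
    _ = (v + N.m c v) + (N.m c' v + N.m c' (N.m c v)) := by abel
    _ = 0 := by rw [h, h2, add_zero]

theorem NR.W (N : NR) (c : A) {v : A} (h : InW v) : InW (N.m c v) := by
  obtain ⟨b, rfl⟩ := h; exact ⟨N.m c b, N.add _ _ _⟩

theorem NR.V (N : NR) (c : A) {v : A} (h : v + v = 0) : N.m c v + N.m c v = 0 := by
  rw [← N.add, h, N.zero]

theorem NR.quasiW (N : NR) {c v : A} (h : InW (v + N.m c v)) : InW v := by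
  obtain ⟨c', hc⟩ := N.quasi c
  have : N.m (c + c' + N.m c c') v = 0 := by rw [hc, N.zero']
  rw [N.add', N.add', N.comm c c', N.assoc] at this
  have h2 := h.add (N.W c' h)
  rw [N.add] at h2
  have e : v = (v + N.m c v) + (N.m c' v + N.m c' (N.m c v)) := by
    calc v = v + (N.m c v + N.m c' v + N.m c' (N.m c v)) := by rw [this, add_zero]
    _ = _ := by abel
  rw [e]; exact h2

theorem stdBas : Bas (1, 0, 0, 0) (0, 1, 0, 0) (0, 0, 1, 0) (0, 0, 0, 1) := by
  constructor <;> (try unfold InW) <;> decide +kernel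

/-- the radical filtration -/
theorem flag (N : NR) : ∃ e1 e2 : A, e1 + e1 = 0 ∧ e2 + e2 = 0 ∧ ¬ InW e1 ∧ ¬ InW e2 ∧
    ¬ InW (e1 + e2) ∧ (∀ a, InW (N.m a e2)) ∧ ∀ a, InW (N.m a e1) ∨ InW (N.m a e1 + e2) := by
  have B := stdBas
  set s1 : A := (1, 0, 0, 0)
  set s2 : A := (0, 1, 0, 0)
  set x : A := (0, 0, 1, 0)
  set y : A := (0, 0, 0, 1)
  -- a vector `v` in `V` with `¬ InW v` has `a v` in `W` or `v + a v ∉ W`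
  have nq : ∀ a v, ¬ InW v → ¬ InW (N.m a v + v) := fun a v h h' => h (N.quasiW (c := a) (by rwa [add_comm]))
  by_cases h : ∀ a, InW (N.m a s1)
  · refine ⟨s2, s1, B.d2, B.d1, B.w2, B.w1, by rw [add_comm]; exact B.w12, h, ?_⟩
    intro a
    rcases V_cases B (N.V a B.d2) with h1 | h1 | h1 | h1
    · exact Or.inl h1
    · exact Or.inr h1
    · exact absurd h1 (nq a _ B.w2)
    · exfalso
      refine nq a (s1 + s2) B.w12 ?_
      rw [N.add]
      have := (h a).add h1
      convert this using 1; abel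
  · push Not at h
    obtain ⟨a, ha⟩ := h
    have hV := N.V a B.d1
    have hi : ¬ InW (s1 + N.m a s1) := fun h => B.w1 (N.quasiW h)
    -- `a s1` is one of `s2`, `s1 + s2` modulo `W`
    have hc : ∀ v, v + v = 0 → InW v ∨ InW (v + s1) ∨ InW (v + N.m a s1) ∨ InW (v + s1 + N.m a s1) := by
      intro v hv
      have hX : InW (N.m a s1 + s2) ∨ InW (N.m a s1 + s1 + s2) := by
        rcases V_cases B hV with h1 | h1 | h1 | h1
        · exact absurd h1 ha
        · exact absurd h1 (nq a _ B.w1)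
        · exact Or.inl h1
        · exact Or.inr h1
      have sub : ∀ {p q r : A}, InW p → InW q → p + q = r + (s1 + s1) + (s2 + s2) → InW r := by
        intro p q r hp hq h
        have := hp.add hq
        rwa [h, B.d1, B.d2, add_zero, add_zero] at this
      rcases V_cases B hv with h1 | h1 | h1 | h1
      · exact Or.inl h1
      · exact Or.inr (Or.inl h1)
      · rcases hX with h2 | h2
        · right; right; left
          refine sub h1 (h2.add ⟨s1, rfl⟩) ?_
          abel
        · right; right; right
          refine sub h1 (h2.add ⟨s1, rfl⟩) ?_
          abel
      · rcases hX with h2 | h2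
        · right; right; right
          refine sub h1 (h2.add ⟨s1, rfl⟩) ?_
          abel
        · right; right; left
          refine sub h1 h2 ?_
          abel
    set e2 := N.m a s1 with he2
    have h12 : ¬ InW (e2 + s1) := by rw [add_comm]; exact hi
    -- b e2
    have hb2 : ∀ b, InW (N.m b e2) := by
      intro b
      rcases hc _ (N.V b hV) with h1 | h1 | h1 | h1
      · exact h1
      · exfalso
        -- b a s1 + s1 ∈ W
        apply nq (N.m b a) s1 B.w1
        rwa [N.assoc]
      · exact absurd h1 (nq b _ ha)
      · exfalso
        -- b e2 + s1 + e2 ∈ W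
        -- s1 + (a + b a) s1
        apply nq (a + N.m b a) s1 B.w1
        rw [N.add', N.assoc, ← he2]
        convert h1 using 1; abel
    refine ⟨s1, e2, B.d1, hV, B.w1, ha, hi, hb2, ?_⟩
    intro b
    rcases hc _ (N.V b B.d1) with h1 | h1 | h1 | h1
    · exact Or.inl h1
    · exact absurd h1 (nq b _ B.w1)
    · exact Or.inr h1
    · exfalso
      apply nq (a + b) s1 B.w1
      rw [N.add', ← he2]
      convert h1 using 1; abel

end BrC
namespace BrC

/-! ### Use of the enumeration -/

theorem loop_spec {f : Nat → St → Option St} {P : Nat → Prop}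
    (hf : ∀ a st, (f a st).isSome = true → P a) :
    ∀ (l : List Nat) (st : St), (loop l f st).isSome = true → ∀ a ∈ l, P a := by
  intro l
  induction l with
  | nil => intro st _ a ha; simp at ha
  | cons b l ih =>
    intro st h a ha
    unfold loop at h
    cases hb : f b st with
    | none => rw [hb] at h; simp at h
    | some st' =>
      rw [hb] at h
      rcases List.mem_cons.mp ha with rfl | ha
      · exact hf _ st (by rw [hb]; rfl)
      · exact ih st' h a ha

theorem guardS_spec {b : Bool} {f : St → Option St} {st : St}
    (h : (guardS b f st).isSome = true) (hb : b = true) : (f st).isSome = true := by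
  subst hb; exact h

theorem takeC_spec {v : Nat → Bool} {st : St} (h : (takeC v st).isSome = true) :
    ∃ c, v c = true := by
  cases st with
  | nil => simp [takeC] at h
  | cons c cs =>
    refine ⟨c, ?_⟩
    have h : (cond (v c) (some cs) none).isSome = true := h
    cases hv : v c
    · rw [hv] at h; simp at h
    · rfl

theorem frcD_eq {α : Type} (D : Dat) (k : Dat → α) : frcD D k = k D := by
  unfold frcD; simp only [frc_eq]

theorem enum1_spec {p11 p12 p22 t1 t2 u : Nat} (h1 : p11 ∈ ev8) (h2 : p12 ∈ ev4) (h3 : p22 ∈ ev4)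
    (hP : okP p11 p12 p22 = true) (h4 : t1 ∈ ev8) (h5 : t2 ∈ ev4)
    (hT : okT p11 p12 p22 t1 t2 = true) (h6 : u ∈ ev16)
    (hU : okU (dat1 p11 p12 p22 t1 t2 u) = true) :
    ∃ c, vf1 (dat1 p11 p12 p22 t1 t2 u) c = true := by
  have H := k_enum1
  unfold enum1 at H
  refine loop_spec (P := fun p11 => ∀ p12 ∈ ev4, ∀ p22 ∈ ev4, okP p11 p12 p22 = true → ∀ t1 ∈ ev8,
    ∀ t2 ∈ ev4, okT p11 p12 p22 t1 t2 = true → ∀ u ∈ ev16, okU (dat1 p11 p12 p22 t1 t2 u) = true →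
    ∃ c, vf1 (dat1 p11 p12 p22 t1 t2 u) c = true) ?_ _ _ H p11 h1 p12 h2 p22 h3 hP t1 h4 t2 h5 hT u h6 hU
  clear H h1 h2 h3 hP h4 h5 hT h6 hU p11 p12 p22 t1 t2 u
  intro p11 st H
  refine loop_spec ?_ _ _ H
  intro p12 st H
  refine loop_spec ?_ _ _ H
  intro p22 st H hP
  have H := guardS_spec H hP
  refine loop_spec ?_ _ _ H
  intro t1 st H
  refine loop_spec ?_ _ _ H
  intro t2 st H hT
  have H := guardS_spec H hT
  refine loop_spec ?_ _ _ H
  intro u st H hU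
  rw [frcD_eq] at H
  exact takeC_spec (guardS_spec H hU)

theorem enum2_spec {w p q : Nat} (h1 : w ∈ [4, 8]) (h2 : p ∈ ev16) (h3 : q ∈ ev16)
    (hg : (asc1 (dat2 w p q) 16 32 32 && sol2 rps2 (dat2 w p q)) = true) :
    ∃ c, vf2 (dat2 w p q) c = true := by
  have H := k_enum2
  unfold enum2 at H
  refine loop_spec (P := fun w => ∀ p ∈ ev16, ∀ q ∈ ev16,
    (asc1 (dat2 w p q) 16 32 32 && sol2 rps2 (dat2 w p q)) = true → ∃ c, vf2 (dat2 w p q) c = true)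
    ?_ _ _ H w h1 p h2 q h3 hg
  clear H h1 h2 h3 hg w p q
  intro w st H
  refine loop_spec ?_ _ _ H
  intro p st H
  refine loop_spec ?_ _ _ H
  intro q st H hg
  rw [frcD_eq] at H
  exact takeC_spec (guardS_spec H hg)

theorem vf1_spec {D : Dat} (v : Vl D) {c : Nat} (h : vf1 D c = true) :
    ∃ k < 25, ∃ e1 < 64, ∃ e2 < 64, ∃ x < 64, ∃ y < 64, chk D (rep k) e1 e2 x y = true := by
  unfold vf1 at h
  simp only [frc_eq, Bool.and_eq_true] at h
  refine ⟨_, Nat.blt_eq.mp h.1, _, ?_, _, ?_, _, ?_, _, ?_, h.2⟩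
  · exact lt_of_lt_of_le (Nat.mod_lt _ (by norm_num)) (by norm_num)
  · exact lt_of_lt_of_le (Nat.mod_lt _ (by norm_num)) (by norm_num)
  · exact Nat.mod_lt _ (by norm_num)
  · exact mulc_lt v _ _

theorem vf2_spec {D : Dat} (v : Vl D) {c : Nat} (h : vf2 D c = true) :
    ∃ k < 25, ∃ e1 < 64, ∃ e2 < 64, ∃ x < 64, ∃ y < 64, chk D (rep k) e1 e2 x y = true := by
  unfold vf2 at h
  simp only [frc_eq, Bool.and_eq_true] at h
  refine ⟨_, Nat.blt_eq.mp h.1, _, ?_, _, ?_, _, ?_, _, ?_, h.2⟩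
  · exact mulc_lt v _ _
  · exact mulc_lt v _ _
  · exact Nat.mod_lt _ (by norm_num)
  · exact Nat.mod_lt _ (by norm_num)

theorem allB_spec {n : Nat} {f : Nat → Bool} (h : allB n f = true) : ∀ k < n, f k = true := by
  induction n with
  | zero => intro k hk; omega
  | succ n ih =>
    intro k hk
    have h' : (f n && allB n f) = true := h
    rw [Bool.and_eq_true] at h'
    rcases Nat.lt_succ_iff_lt_or_eq.mp hk with h1 | rfl
    · exact ih h'.2 k h1
    · exact h'.1

theorem mdl_spec {k : Nat} (hk : k < 25) : mdl k = true := by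
  have := allB_spec k_mdl k hk
  rwa [frc_eq] at this

theorem vld_spec {D : Dat} (h : vld D = true) : Vl D ∧ D.p11 < 16 ∧ D.p12 < 16 ∧ D.p22 < 16 ∧
    D.t1 < 16 ∧ D.t2 < 16 ∧ D.s1 < 16 ∧ D.s2 < 16 := by
  unfold vld at h
  simp only [Bool.and_eq_true, Nat.blt_eq] at h
  obtain ⟨a, b, c, d, e, f, g, h, i, j⟩ := h
  refine ⟨⟨?_, ?_, ?_, ?_, ?_, ?_, ?_, ?_, ?_, ?_⟩, ?_, ?_, ?_, ?_, ?_, ?_, ?_⟩ <;> omega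

theorem rep_vl {k : Nat} (hk : k < 25) : Vl (rep k) := by
  have := mdl_spec hk
  unfold mdl at this
  rw [Bool.and_eq_true] at this
  exact (vld_spec this.1).1

def HasK (N : NR) (k : Nat) : Prop := ∃ e1 e2 x y, Sys N.m (rep k) e1 e2 x y

/-! ### Counting -/

theorem cntL_cons (a : Nat) (l : List Nat) (f : Nat → Bool) :
    cntL (a :: l) f = (f a).toNat + cntL l f := by
  show cond (f a) (Nat.succ (cntL l f)) (cntL l f) = _
  cases f a <;> simp [Nat.add_comm]

theorem cntL_nil (f : Nat → Bool) : cntL [] f = 0 := rfl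

theorem sum64 (h : Nat → Nat) : ∑ n ∈ Finset.range 64, h (n &&& 51) =
    4 * (h 0 + h 1 + h 2 + h 3 + h 16 + h 17 + h 18 + h 19 + h 32 + h 33 + h 34 + h 35 + h 48 + h 49
      + h 50 + h 51) := by
  simp only [Finset.sum_range_succ, Finset.sum_range_zero, Nat.reduceAnd]
  ring

theorem land_W : ∀ n < 64, ∃ w ∈ ev4, n = addc (n &&& 51) w ∧ (n &&& 51) < 64 := by decide +kernel

theorem sol_iff {N : Bil} {D : Dat} {e1 e2 x y : A} (S : Sys N.m D e1 e2 x y) {n : Nat} (hn : n < 64) :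
    sol D n = true ↔ ev e1 e2 x y n + ev e1 e2 x y n + N.m (ev e1 e2 x y n) (ev e1 e2 x y n) = 0 := by
  unfold sol
  rw [Nat.beq_eq, mul_ev S, ← ev_dblc S.B.d1 S.B.d2 x y hn,
    ← ev_addc S.B.d1 S.B.d2 x y (dblc_bd n hn) (mulc_lt S.vl _ _)]
  exact ⟨fun h => by rw [h, ev_zero], ev_eq_zero S.B (addc_lt (dblc_bd n hn) (mulc_lt S.vl _ _))⟩

theorem sq_W (N : Bil) (a b : A) : (a + (b + b)) + (a + (b + b)) + N.m (a + (b + b)) (a + (b + b)) =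
    a + a + N.m a a := by
  simp only [N.add, N.add', N.comm b a]
  have h1 := four b
  have h2 := four (N.m a b)
  have h3 := four (N.m b b)
  calc _ = a + a + N.m a a + (b + b + (b + b)) + (N.m a b + N.m a b + (N.m a b + N.m a b)) +
      (N.m b b + N.m b b + (N.m b b + N.m b b)) := by abel
    _ = _ := by rw [h1, h2, h3]; simp

theorem sol_count {N : NR} (G : Good N) {D : Dat} {e1 e2 x y : A} (S : Sys N.m D e1 e2 x y) :
    cntL rps2 (sol D) < 2 := by
  have hinv : ∀ n < 64, sol D n = sol D (n &&& 51) := by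
    intro n hn
    obtain ⟨w, hw, h, hl⟩ := land_W n hn
    have hw' : w < 64 ∧ InW (ev e1 e2 x y w) := by
      have : w < 64 ∧ Nat.land w 51 = 0 := by clear h; revert w; decide
      exact ⟨this.1, (InW_ev S.B this.1).2 this.2⟩
    rw [Bool.eq_iff_iff, sol_iff S hn, sol_iff S hl]
    obtain ⟨b, hb⟩ := hw'.2
    have : ev e1 e2 x y n = ev e1 e2 x y (n &&& 51) + (b + b) := by
      rw [← hb, ← ev_addc S.B.d1 S.B.d2 x y hl hw'.1, ← h]
    rw [this, sq_W]
  have hc : ∑ n ∈ Finset.range 64, (sol D n).toNat = 8 := by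
    have := G.cnt
    have e : Nat.card {n : Fin 64 // sol D n.1 = true} = 8 := by
      rw [← this]
      apply Nat.card_congr
      refine (Equiv.ofBijective _ (ev_bij S.B)).subtypeEquiv ?_
      intro n
      exact sol_iff S n.2
    rw [Nat.card_eq_fintype_card, Fintype.card_subtype, Finset.card_filter] at e
    rw [← e, Finset.sum_range]
    apply Finset.sum_congr rfl
    intro i _
    cases sol D i.1 <;> simp
  rw [Finset.sum_congr rfl (fun n hn => by rw [hinv n (Finset.mem_range.mp hn)]),
    sum64 (fun n => (sol D n).toNat)] at hc
  have h0 : sol D 0 = true := by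
    rw [sol_iff S (by norm_num), ev_zero, N.zero]; simp
  rw [h0] at hc
  unfold rps2
  simp only [cntL_cons, cntL_nil]
  simp only [Bool.toNat_true] at hc
  omega

theorem sol_count1 (D : Dat) (h : cntL rps2 (sol D) < 2) : cntL rps1 (sol D) < 2 := by
  unfold rps2 at h
  unfold rps1
  simp only [cntL_cons, cntL_nil] at *
  omega

theorem small_bits : ∀ c < 16, tb c 4 = 0 ∧ tb c 5 = 0 := by decide +kernel

theorem ev_congr {e1 e2 x y x' y' : A} {c : Nat} (hc : c < 16) (hx : x + x = x' + x')
    (hy : y + y = y' + y') : ev e1 e2 x y c = ev e1 e2 x' y' c := by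
  unfold ev cx cy
  rw [(small_bits c hc).1, (small_bits c hc).2]
  calc _ = tb c 0 • e1 + tb c 1 • e2 + tb c 2 • (x + x) + tb c 3 • (y + y) := by module
    _ = _ := by rw [hx, hy]; module

theorem map_ev16 {f : A → A} (hf : ∀ a b, f (a + b) = f a + f b) {e1 e2 x y : A} (B : Bas e1 e2 x y)
    {c a1 a2 ax ay : Nat} (hc : c < 16)
    (l1 : a1 < 64) (l2 : a2 < 64) (lx : ax < 64) (ly : ay < 64)
    (h1 : f e1 = ev e1 e2 x y a1) (h2 : f e2 = ev e1 e2 x y a2)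
    (hx : f x + f x = ev e1 e2 x y ax + ev e1 e2 x y ax)
    (hy : f y + f y = ev e1 e2 x y ay + ev e1 e2 x y ay) :
    f (ev e1 e2 x y c) = ev e1 e2 x y (lin a1 a2 ax ay c) := by
  rw [ev_lin B.d1 B.d2 x y l1 l2 lx ly, map_ev f hf, h1, h2, ev_congr hc hx hy]

theorem mem16 : ∀ c < 16, c ∈ ev16 := by decide
theorem mem4 : ∀ c < 64, Nat.land c 51 = 0 → c ∈ ev4 := by decide +kernel
theorem mem8 : ∀ c < 64, Nat.land c 51 = 0 ∨ Nat.land (addc c 2) 51 = 0 → c ∈ ev8 := by decide +kernel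
theorem mem4_lt : ∀ c ∈ ev4, c < 16 := by decide
theorem mem8_lt : ∀ c ∈ ev8, c < 16 := by decide

theorem code16 {e1 e2 x y : A} (B : Bas e1 e2 x y) {t : A} (h : t + t = 0) :
    ∃ c < 16, t = ev e1 e2 x y c := by
  obtain ⟨k, hk, rfl⟩ := ev_surj B t
  exact ⟨k, (V_code k hk ((dbl_ev B hk).1 h)).1, rfl⟩

theorem code4 {e1 e2 x y : A} (B : Bas e1 e2 x y) {t : A} (h : InW t) :
    ∃ c ∈ ev4, t = ev e1 e2 x y c := by
  obtain ⟨k, hk, rfl⟩ := ev_surj B t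
  exact ⟨k, mem4 k hk ((InW_ev B hk).1 h), rfl⟩

theorem code8 {e1 e2 x y : A} (B : Bas e1 e2 x y) {t : A} (h : InW t ∨ InW (t + e2)) :
    ∃ c ∈ ev8, t = ev e1 e2 x y c := by
  obtain ⟨k, hk, rfl⟩ := ev_surj B t
  refine ⟨k, mem8 k hk ?_, rfl⟩
  rw [← InW_ev B hk, ← InW_ev B (addc_lt hk (by norm_num)), ev_addc B.d1 B.d2 x y hk (by norm_num), ev_2]
  exact h

theorem case1 {N : NR} (G : Good N) {x : A} (hx : N.m x x + N.m x x ≠ 0) : ∃ k < 25, HasK N k := by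
  obtain ⟨e1, e2, d1, d2, w1, w2, w12, f2, f1⟩ := flag N
  obtain ⟨y, hy⟩ : ∃ y, y = N.m x x := ⟨_, rfl⟩
  rw [← hy] at hx
  have key : ∀ v c, InW v → N.m c v = v → v = 0 := by
    intro v c hv h
    apply N.quasi0 (c := c)
    rw [h]; exact hv.dbl
  have hyy : y + y = N.m x (x + x) := by rw [N.add, ← hy]
  have hx2 : x + x ≠ 0 := by
    intro h; apply hx; rw [hyy, h, N.zero]
  have B : Bas e1 e2 x y := by
    refine ⟨d1, d2, w1, w2, w12, hx2, hx, ?_⟩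
    intro h
    exact hx2 (key _ x ⟨x, rfl⟩ (by rw [← hyy, h]))
  have hu : N.m x y + N.m x y = 0 := by
    have e : N.m x y + N.m x y = N.m y (x + x) := by rw [N.add, N.comm y x]
    have e' : N.m x y + N.m x y = N.m x (y + y) := by rw [N.add]
    rcases W_cases B ⟨N.m x y, rfl⟩ with h | h | h | h
    · exact h
    · exact absurd (key _ y ⟨x, rfl⟩ (by rw [← e, h])) hx2
    · exact absurd (key _ x ⟨y, rfl⟩ (by rw [← e', h])) hx
    · exfalso; apply hx2
      apply N.quasi0 (c := x + y)
      rw [N.add', ← e, ← hyy, h]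
      rw [show x + x + (y + y + (x + x + (y + y))) = (x + x + (x + x)) + (y + y + (y + y)) by abel, four, four, add_zero]
  obtain ⟨p11, m11, E11⟩ := code8 B (f1 e1)
  obtain ⟨p12, m12, E12⟩ := code4 B (f2 e1)
  obtain ⟨p22, m22, E22⟩ := code4 B (f2 e2)
  obtain ⟨t1, mt1, Et1⟩ := code8 B (f1 x)
  obtain ⟨t2, mt2, Et2⟩ := code4 B (f2 x)
  obtain ⟨u, lu, Eu⟩ := code16 B hu
  have b11 := mem8_lt _ m11
  have b12 := mem4_lt _ m12
  have b22 := mem4_lt _ m22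
  have bt1 := mem8_lt _ mt1
  have bt2 := mem4_lt _ mt2
  have X : ∀ c < 16, N.m x (ev e1 e2 x y c) = ev e1 e2 x y (lin t1 t2 32 0 c) := by
    intro c hc
    refine map_ev16 (N.add x) B hc (by omega) (by omega) (by norm_num) (by norm_num) Et1 Et2 ?_ ?_
    · rw [ev_32, hy]
    · rw [ev_zero, hu, add_zero]
  have dz : ∀ e z : A, e + e = 0 → N.m e z + N.m e z = ev e1 e2 x y 0 + ev e1 e2 x y 0 := by
    intro e z h
    rw [ev_zero, ← N.add', h, N.zero', add_zero]
  have Y1 : ∀ c < 16, N.m e1 (ev e1 e2 x y c) = ev e1 e2 x y (lin p11 p12 0 0 c) := by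
    intro c hc
    exact map_ev16 (N.add e1) B hc (by omega) (by omega) (by norm_num) (by norm_num) E11 E12
      (dz _ _ d1) (dz _ _ d1)
  have Y2 : ∀ c < 16, N.m e2 (ev e1 e2 x y c) = ev e1 e2 x y (lin p12 p22 0 0 c) := by
    intro c hc
    exact map_ev16 (N.add e2) B hc (by omega) (by omega) (by norm_num) (by norm_num) (by rw [N.comm, E12]) E22
      (dz _ _ d2) (dz _ _ d2)
  have LX : ∀ c, lin t1 t2 32 0 c < 64 := fun c => lin_lt (by omega) (by omega) (by norm_num) (by norm_num) c
  have L1 : ∀ c, lin p11 p12 0 0 c < 64 := fun c => lin_lt (by omega) (by omega) (by norm_num) (by norm_num) c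
  have L2 : ∀ c, lin p12 p22 0 0 c < 64 := fun c => lin_lt (by omega) (by omega) (by norm_num) (by norm_num) c
  have Es1 : N.m y e1 = ev e1 e2 x y (lin t1 t2 32 0 t1) := by
    rw [← X _ bt1, ← Et1, ← N.assoc, ← hy]
  have Es2 : N.m y e2 = ev e1 e2 x y (lin t1 t2 32 0 t2) := by
    rw [← X _ bt2, ← Et2, ← N.assoc, ← hy]
  have bs1 : lin t1 t2 32 0 t1 < 16 := by
    refine (V_code _ (LX _) ((dbl_ev B (LX _)).1 ?_)).1
    rw [← Es1]; exact N.V y d1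
  have bs2 : lin t1 t2 32 0 t2 < 16 := by
    refine (V_code _ (LX _) ((dbl_ev B (LX _)).1 ?_)).1
    rw [← Es2]; exact N.V y d2
  have v : Vl (dat1 p11 p12 p22 t1 t2 u) := by
    constructor <;> simp only [dat1] <;> first | exact LX _ | omega
  have S : Sys N.m (dat1 p11 p12 p22 t1 t2 u) e1 e2 x y := by
    refine ⟨B, v, E11, E12, E22, Et1, Et2, Es1, Es2, ?_, Eu, ?_⟩
    · show _ = ev e1 e2 x y 32
      rw [ev_32, hy]
    · show _ = ev e1 e2 x y (lin t1 t2 32 0 u)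
      rw [← X _ lu, ← Eu, ← N.assoc, ← hy]
  have hP : okP p11 p12 p22 = true := by
    unfold okP
    simp only [Bool.and_eq_true, Nat.beq_eq]
    constructor
    · apply ev_inj B (L2 _) (L1 _)
      rw [← Y2 _ b11, ← Y1 _ b12, ← E11, ← E12, N.comm, N.assoc]
    · apply ev_inj B (L2 _) (L1 _)
      rw [← Y2 _ b12, ← Y1 _ b22, ← E12, ← E22, N.comm, N.assoc]
  have hT : okT p11 p12 p22 t1 t2 = true := by
    unfold okT
    simp only [Bool.and_eq_true, Nat.beq_eq]
    refine ⟨?_, ?_, ?_, ?_⟩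
    · apply ev_inj B (L1 _) (LX _)
      rw [← Y1 _ bt1, ← X _ b11, ← E11, ← Et1, N.comm, N.assoc]
    · apply ev_inj B (L2 _) (LX _)
      rw [← Y2 _ bt1, ← X _ b12, ← E12, ← Et1, N.comm, N.assoc]
    · apply ev_inj B (L1 _) (LX _)
      rw [← Y1 _ bt2, ← X _ b12, ← E12, ← Et2, N.comm, N.assoc, N.comm e2]
    · apply ev_inj B (L2 _) (LX _)
      rw [← Y2 _ bt2, ← X _ b22, ← E22, ← Et2, N.comm, N.assoc]
  have hU : okU (dat1 p11 p12 p22 t1 t2 u) = true := by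
    unfold okU
    simp only [Bool.and_eq_true, Nat.beq_eq]
    refine ⟨?_, ?_, ?_⟩
    · apply ev_inj B (L1 _) (LX _)
      show ev e1 e2 x y (lin p11 p12 0 0 u) = ev e1 e2 x y (lin t1 t2 32 0 (lin t1 t2 32 0 t1))
      rw [← Y1 _ lu, ← X _ bs1, ← Eu, ← Es1, N.comm, N.assoc]
    · apply ev_inj B (L2 _) (LX _)
      show ev e1 e2 x y (lin p12 p22 0 0 u) = ev e1 e2 x y (lin t1 t2 32 0 (lin t1 t2 32 0 t2))
      rw [← Y2 _ lu, ← X _ bs2, ← Eu, ← Es2, N.comm, N.assoc]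
    · unfold sol2
      rw [Nat.blt_eq]
      exact sol_count1 _ (sol_count G S)
  obtain ⟨c, hc⟩ := enum1_spec m11 m12 m22 hP mt1 mt2 hT (mem16 _ lu) hU
  obtain ⟨k, hk, n1, l1, n2, l2, nx, lx, ny, ly, h⟩ := vf1_spec v hc
  exact ⟨k, hk, _, _, _, _, (chk_iff S (rep_vl hk) l1 l2 lx ly).2 h⟩

theorem ex_z : ∀ x : A, x + x ≠ 0 → ∃ z : A, z + z ≠ 0 ∧ x + x ≠ z + z := by decide +kernel

theorem case2 {N : NR} (G : Good N) (hN : ∀ x, N.m x x + N.m x x = 0) : ∃ k < 25, HasK N k := by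
  have hS := stdBas
  have key : ∀ v c, InW v → N.m c v = v → v = 0 := by
    intro v c hv h
    apply N.quasi0 (c := c)
    rw [h]; exact hv.dbl
  have hab : ∀ a b, N.m a b + N.m a b = 0 := by
    intro a b
    by_contra h
    have e1 : N.m a b + N.m a b = N.m a (b + b) := by rw [N.add]
    have e2 : N.m a b + N.m a b = N.m b (a + a) := by rw [N.add, N.comm]
    have ha : a + a ≠ 0 := by intro h'; apply h; rw [e2, h', N.zero]
    have hb : b + b ≠ 0 := by intro h'; apply h; rw [e1, h', N.zero]
    have hne : a + a ≠ b + b := by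
      intro h'; apply h; rw [e1, ← h', N.add, hN]
    have B : Bas (1, 0, 0, 0) (0, 1, 0, 0) a b :=
      ⟨hS.d1, hS.d2, hS.w1, hS.w2, hS.w12, ha, hb, hne⟩
    rcases W_cases B ⟨N.m a b, rfl⟩ with h1 | h1 | h1 | h1
    · exact h h1
    · exact ha (key _ b ⟨a, rfl⟩ (by rw [← e2, h1]))
    · exact hb (key _ a ⟨b, rfl⟩ (by rw [← e1, h1]))
    · have h2 : N.m a (N.m a b + N.m a b) = 0 := by
        rw [N.add, ← N.assoc, ← N.add', hN, N.zero']
      rw [h1, N.add, N.add, hN, zero_add, ← e1] at h2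
      exact h h2
  have hW : ∀ c v, InW v → N.m c v = 0 := by
    rintro c v ⟨b, rfl⟩; rw [N.add, hab]
  obtain ⟨x, b, hb, hx⟩ := G.ex
  obtain ⟨e1, he1⟩ : ∃ e1, e1 = N.m x x := ⟨_, rfl⟩
  obtain ⟨e2, he2⟩ : ∃ e2, e2 = N.m x e1 := ⟨_, rfl⟩
  obtain ⟨f, hf⟩ : ∃ f, f = N.m x e2 := ⟨_, rfl⟩
  have h11 : N.m e1 e1 = f := by
    rw [hf, he2]; conv_lhs => rw [he1]
    rw [N.assoc, ← he1]
  have hf0 : f ≠ 0 := by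
    intro h
    apply hx
    rw [hb, ← he1, N.add, hW _ _ ⟨x, rfl⟩, N.add', N.comm (x + x), hW _ _ ⟨x, rfl⟩, h11, h, add_zero, add_zero]
    have h3 : e1 + e1 = 0 := by rw [he1, hab]
    rw [show x + x + e1 + (x + x + e1) = (x + x + (x + x)) + (e1 + e1) by abel, four, h3, add_zero, add_zero]
  have d1 : e1 + e1 = 0 := by rw [he1, hab]
  have d2 : e2 + e2 = 0 := by rw [he2, hab]
  have w2 : ¬ InW e2 := fun h => hf0 (by rw [hf, hW _ _ h])
  have w1 : ¬ InW e1 := fun h => w2 (by rw [he2, hW _ _ h]; exact InW.zero)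
  have w12 : ¬ InW (e1 + e2) := by
    intro h
    rw [he2] at h
    exact w1 (N.quasiW h)
  have B0 : Bas e1 e2 (0, 0, 1, 0) (0, 0, 0, 1) := ⟨d1, d2, w1, w2, w12, hS.dx, hS.dy, hS.dxy⟩
  have fW : InW f := by
    have df : f + f = 0 := by rw [hf, hab]
    rcases V_cases B0 df with h | h | h | h
    · exact h
    · exfalso; apply w1
      apply N.quasiW (c := e1)
      rw [h11, add_comm]; exact h
    · exfalso; apply w2
      apply N.quasiW (c := x)
      rw [← hf, add_comm]; exact h
    · exfalso; apply w1
      apply N.quasiW (c := e1 + x)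
      rw [N.add', h11, ← he2]
      convert h using 1; abel
  have hx0 : x + x ≠ 0 := by
    intro h
    have hxW : ¬ InW x := by
      intro h'
      apply w1; rw [he1, hW _ _ h']; exact InW.zero
    rcases V_cases B0 h with h | h | h | h
    · exact hxW h
    · apply hxW; apply N.quasiW (c := x); rwa [← he1]
    · apply hxW; apply N.quasiW (c := e1); rwa [N.comm, ← he2]
    · apply hxW; apply N.quasiW (c := x + e1); rw [N.add', ← he1, N.comm e1, ← he2, ← add_assoc]; exact h
  obtain ⟨z, w, hz, hxz, hw, hfw⟩ : ∃ z w, z + z ≠ 0 ∧ x + x ≠ z + z ∧ w ∈ [4, 8] ∧ f = ev e1 e2 x z w := by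
    by_cases h : f = x + x
    · obtain ⟨z, h1, h2⟩ := ex_z x hx0
      exact ⟨z, 4, h1, h2, by decide, by rw [ev_4, h]⟩
    · obtain ⟨z, rfl⟩ := fW
      exact ⟨z, 8, hf0, fun h' => h h'.symm, by decide, by rw [ev_8]⟩
  have B : Bas e1 e2 x z := ⟨d1, d2, w1, w2, w12, hx0, hz, hxz⟩
  have bw : w < 16 := by clear hfw; revert w; decide
  obtain ⟨p, lp, Ep⟩ := code16 B (hab x z)
  obtain ⟨q, lq, Eq⟩ := code16 B (hab z z)
  have X : ∀ c < 16, N.m x (ev e1 e2 x z c) = ev e1 e2 x z (lin 2 w 0 0 c) := by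
    intro c hc
    refine map_ev16 (N.add x) B hc (by omega) (by omega) (by norm_num) (by norm_num) ?_ ?_ ?_ ?_
    · rw [ev_2, ← he2]
    · rw [← hf, hfw]
    · rw [ev_zero, hab, add_zero]
    · rw [ev_zero, hab, add_zero]
  have LX : ∀ c, lin 2 w 0 0 c < 64 := fun c => lin_lt (by omega) (by omega) (by norm_num) (by norm_num) c
  have Es1 : N.m z e1 = ev e1 e2 x z (lin 2 w 0 0 p) := by
    rw [← X _ lp, ← Ep, he1, ← N.assoc, N.comm z x, N.comm]
  have bs1 : lin 2 w 0 0 p < 16 := by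
    refine (V_code _ (LX _) ((dbl_ev B (LX _)).1 ?_)).1
    rw [← Es1, hab]
  have Es2 : N.m z e2 = ev e1 e2 x z (lin 2 w 0 0 (lin 2 w 0 0 p)) := by
    rw [← X _ bs1, ← Es1, he2, ← N.assoc, N.comm z x, N.assoc]
  have v : Vl (dat2 w p q) := by
    constructor <;> simp only [dat2] <;> first | exact LX _ | omega
  have E12 : N.m e1 e2 = 0 := by
    rw [N.comm, he2, N.assoc, h11, hW _ _ fW]
  have S : Sys N.m (dat2 w p q) e1 e2 x z := by
    refine ⟨B, v, ?_, ?_, ?_, ?_, ?_, Es1, Es2, ?_, Ep, Eq⟩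
    · rw [h11]; exact hfw
    · show _ = ev e1 e2 x z 0
      rw [ev_zero, E12]
    · show _ = ev e1 e2 x z 0
      conv_lhs => rw [he2]
      rw [ev_zero, N.assoc, ← he2, E12, N.zero]
    · show _ = ev e1 e2 x z 2
      rw [ev_2, he2]
    · rw [← hf]; exact hfw
    · show _ = ev e1 e2 x z 1
      rw [ev_1, he1]
  have hg : (asc1 (dat2 w p q) 16 32 32 && sol2 rps2 (dat2 w p q)) = true := by
    unfold asc1 sol2
    simp only [Bool.and_eq_true, Nat.beq_eq, Nat.blt_eq]
    refine ⟨?_, sol_count G S⟩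
    apply ev_inj B (mulc_lt v _ _) (mulc_lt v _ _)
    rw [← mul_ev S, ← mul_ev S, ← mul_ev S, ← mul_ev S, N.assoc]
  obtain ⟨c, hc⟩ := enum2_spec hw (mem16 _ lp) (mem16 _ lq) hg
  obtain ⟨k, hk, n1, l1, n2, l2, nx, lx, ny, ly, h⟩ := vf2_spec v hc
  exact ⟨k, hk, _, _, _, _, (chk_iff S (rep_vl hk) l1 l2 lx ly).2 h⟩

theorem exists_k {N : NR} (G : Good N) : ∃ k < 25, HasK N k := by
  by_cases h : ∀ x, N.m x x + N.m x x = 0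
  · exact case2 G h
  · push Not at h
    obtain ⟨x, hx⟩ := h
    exact case1 G hx

end BrC
namespace BrC

/-! ### Isomorphisms and invariance -/

theorem iso_of_sys {L L' : LeftBrace (Fin 64)} {N N' : NR} (R : Rp L N) (R' : Rp L' N') {D : Dat}
    {e1 e2 x y e1' e2' x' y' : A} (S : Sys N.m D e1 e2 x y) (S' : Sys N'.m D e1' e2' x' y') :
    L.Iso L' := by
  obtain ⟨e, ha, hm⟩ := R
  obtain ⟨e', ha', hm'⟩ := R'
  obtain ⟨T, hT⟩ : ∃ T : A ≃ A, ∀ n < 64, T (ev e1 e2 x y n) = ev e1' e2' x' y' n := by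
    refine ⟨(Equiv.ofBijective _ (ev_bij S.B)).symm.trans (Equiv.ofBijective _ (ev_bij S'.B)), ?_⟩
    intro n hn
    have : ev e1 e2 x y n = Equiv.ofBijective _ (ev_bij S.B) (⟨n, hn⟩ : Fin 64) := rfl
    rw [this, Equiv.trans_apply, Equiv.symm_apply_apply]
    rfl
  have Ta : ∀ a b, T (a + b) = T a + T b := by
    intro a b
    obtain ⟨n, hn, rfl⟩ := ev_surj S.B a
    obtain ⟨k, hk, rfl⟩ := ev_surj S.B b
    rw [← ev_addc S.B.d1 S.B.d2 x y hn hk, hT _ (addc_lt hn hk), hT _ hn, hT _ hk,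
      ev_addc S'.B.d1 S'.B.d2 x' y' hn hk]
  have Tm : ∀ a b, T (N.m a b) = N'.m (T a) (T b) := by
    intro a b
    obtain ⟨n, hn, rfl⟩ := ev_surj S.B a
    obtain ⟨k, hk, rfl⟩ := ev_surj S.B b
    rw [mul_ev S, hT _ (mulc_lt S.vl _ _), hT _ hn, hT _ hk, mul_ev S']
  refine ⟨e.trans (T.trans e'.symm), ?_, ?_⟩
  · intro a b
    simp only [Equiv.trans_apply]
    rw [Equiv.symm_apply_eq, ha', ha, Ta, Equiv.apply_symm_apply, Equiv.apply_symm_apply]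
  · intro a b
    simp only [Equiv.trans_apply]
    rw [Equiv.symm_apply_eq, hm', hm, Ta, Ta, Tm, Equiv.apply_symm_apply, Equiv.apply_symm_apply]

theorem Rp_iso {L L' : LeftBrace (Fin 64)} (h : L.Iso L') {N : NR} (R : Rp L' N) : Rp L N := by
  obtain ⟨φ, h1, h2⟩ := h
  obtain ⟨e, ha, hm⟩ := R
  refine ⟨φ.trans e, ?_, ?_⟩
  · intro a b; simp only [Equiv.trans_apply]; rw [h1, ha]
  · intro a b; simp only [Equiv.trans_apply]; rw [h2, hm]

theorem HasK_transport {L : LeftBrace (Fin 64)} {N N' : NR} (R : Rp L N) (R' : Rp L N') {k : Nat}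
    (h : HasK N' k) : HasK N k := by
  obtain ⟨e, ha, hm⟩ := R
  obtain ⟨e', ha', hm'⟩ := R'
  obtain ⟨e1, e2, x, y, S⟩ := h
  let T : A ≃ A := e'.symm.trans e
  have Ta : ∀ a b, T (a + b) = T a + T b := by
    intro a b
    have : a + b = e' (L.add (e'.symm a) (e'.symm b)) := by
      rw [ha', Equiv.apply_symm_apply, Equiv.apply_symm_apply]
    show e (e'.symm (a + b)) = _
    rw [this, Equiv.symm_apply_apply, ha]; rfl
  have Tm : ∀ a b, T (N'.m a b) = N.m (T a) (T b) := by
    intro a b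
    have : a + b + N'.m a b = e' (L.mul (e'.symm a) (e'.symm b)) := by
      rw [hm', Equiv.apply_symm_apply, Equiv.apply_symm_apply]
    have h2 : T (a + b + N'.m a b) = T a + T b + N.m (T a) (T b) := by
      show e (e'.symm (a + b + N'.m a b)) = _
      rw [this, Equiv.symm_apply_apply, hm]; rfl
    rw [Ta, Ta] at h2
    exact add_left_cancel h2
  have T0 : T 0 = 0 := by
    have := Ta 0 0
    rw [add_zero] at this
    exact add_eq_left.mp this.symm
  have TW : ∀ a, InW (T a) → InW a := by
    rintro a ⟨b, hb⟩
    refine ⟨T.symm b, ?_⟩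
    apply T.injective
    rw [Ta, hb, Equiv.apply_symm_apply]
  have Te : ∀ n, T (ev e1 e2 x y n) = ev (T e1) (T e2) (T x) (T y) n := map_ev T Ta e1 e2 x y
  refine ⟨T e1, T e2, T x, T y, ?_⟩
  constructor
  · constructor
    · rw [← Ta, S.B.d1, T0]
    · rw [← Ta, S.B.d2, T0]
    · exact fun h => S.B.w1 (TW _ h)
    · exact fun h => S.B.w2 (TW _ h)
    · rw [← Ta]; exact fun h => S.B.w12 (TW _ h)
    · rw [← Ta, ← T0]; exact fun h => S.B.dx (T.injective h)
    · rw [← Ta, ← T0]; exact fun h => S.B.dy (T.injective h)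
    · rw [← Ta, ← Ta]; exact fun h => S.B.dxy (T.injective h)
  · exact S.vl
  · rw [← Tm, S.p11, Te]
  · rw [← Tm, S.p12, Te]
  · rw [← Tm, S.p22, Te]
  · rw [← Tm, S.t1, Te]
  · rw [← Tm, S.t2, Te]
  · rw [← Tm, S.s1, Te]
  · rw [← Tm, S.s2, Te]
  · rw [← Tm, S.xx, Te]
  · rw [← Tm, S.xy, Te]
  · rw [← Tm, S.yy, Te]

/-! ### The representatives are different -/

theorem allL_spec {α : Type} {l : List α} {f : α → Bool} (h : allL l f = true) : ∀ a ∈ l, f a = true := by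
  induction l with
  | nil => intro a ha; simp at ha
  | cons b l ih =>
    intro a ha
    have h' : (f b && allL l f) = true := h
    rw [Bool.and_eq_true] at h'
    rcases List.mem_cons.mp ha with rfl | ha
    · exact h'.1
    · exact ih h'.2 a ha

theorem prs_spec {f : Dat → List Dat → Bool} : ∀ {l : List Dat}, prs f l = true → ∀ i j, i < j → j < l.length →
    ∃ Es, f (l.getD i zD) Es = true ∧ l.getD j zD ∈ Es := by
  intro l
  induction l with
  | nil => intro _ i j _ hj; simp at hj
  | cons b l ih =>
    intro h i j hij hj
    have h' : (f b l && prs f l) = true := h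
    rw [Bool.and_eq_true] at h'
    obtain ⟨j, rfl⟩ : ∃ j', j = j' + 1 := ⟨j - 1, by omega⟩
    rw [List.length_cons] at hj
    have hj' : j < l.length := by omega
    rw [List.getD_cons_succ]
    cases i with
    | zero =>
      refine ⟨l, ?_, ?_⟩
      · rw [List.getD_cons_zero]; exact h'.1
      · rw [List.getD_eq_getElem _ _ hj']; exact List.getElem_mem _
    | succ i =>
      rw [List.getD_cons_succ]
      exact ih h'.2 i j (by omega) hj'

theorem mem_lt16 : ∀ n < 64, dblc n = 0 → Nat.land n 51 ≠ 0 → n ∈ lt16 := by decide +kernel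

theorem lin_zero {n1 n2 nx ny c : Nat} (h : tb c 0 = 0) : lin n1 n2 nx ny c = lin 0 n2 nx ny c := by
  rw [lin_eq, lin_eq, h]; rfl

theorem nos1_absurd {N : NR} {D E : Dat} {Es : List Dat} (hE : E ∈ Es) (hn : nos1 D Es = true)
    (sE : sid1 E = true) {e1 e2 x y e1' e2' x' y' : A}
    (S : Sys N.m D e1 e2 x y) (S' : Sys N.m E e1' e2' x' y') : False := by
  obtain ⟨n1, l1, rfl⟩ := ev_surj S.B e1'
  obtain ⟨n2, l2, rfl⟩ := ev_surj S.B e2'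
  obtain ⟨nx, lx, rfl⟩ := ev_surj S.B x'
  obtain ⟨ny, ly, rfl⟩ := ev_surj S.B y'
  have hc := (chk_iff S S'.vl l1 l2 lx ly).1 S'
  unfold sid1 at sE
  simp only [Bool.and_eq_true, Nat.beq_eq] at sE
  obtain ⟨s1, s2, s3⟩ := sE
  have hny : ny = mulc D nx nx := by
    apply ev_inj S.B ly (mulc_lt S.vl _ _)
    rw [← mul_ev S, S'.xx, s1, ev_32]
  have m1 : n1 ∈ lt16 := mem_lt16 n1 l1 ((dbl_ev S.B l1).1 S'.B.d1) (fun h => S'.B.w1 ((InW_ev S.B l1).2 h))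
  have m2 : n2 ∈ lt16 := mem_lt16 n2 l2 ((dbl_ev S.B l2).1 S'.B.d2) (fun h => S'.B.w2 ((InW_ev S.B l2).2 h))
  have hd : dblc ny ≠ 0 := fun h => S'.B.dy ((dbl_ev S.B ly).2 h)
  unfold nos1 at hn
  have h := allB_spec hn nx lx
  simp only [frc_eq] at h
  rw [← hny, Bool.or_eq_true, Nat.beq_eq] at h
  have h := allL_spec (h.resolve_left hd) n2 m2
  have h := allL_spec h E hE
  rw [Bool.or_eq_true] at h
  have hc' := hc
  unfold chk at hc'
  simp only [Bool.and_eq_true, Nat.beq_eq] at hc'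
  obtain ⟨a0, a1, a2, a3, a4, a5, a6, -⟩ := hc'
  rcases h with h | h
  · rw [Bool.not_eq_true', ← Bool.not_eq_true] at h
    apply h
    simp only [Bool.and_eq_true, Nat.beq_eq, Bool.or_eq_true, nz_iff]
    refine ⟨?_, ?_, ?_⟩
    · rw [a6, lin_zero s2]
    · rw [a5, lin_zero s3]
    · by_cases h0 : tb E.xy 0 = 0
      · right; rw [a3, lin_zero h0]
      · left; exact h0
  · have h := allL_spec h n1 m1
    rw [hc] at h
    simp at h

theorem nos2_absurd {N : NR} {D E : Dat} {Es : List Dat} (hE : E ∈ Es) (hn : nos2 D Es = true)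
    (sE : sid2 E = true) {e1 e2 x y e1' e2' x' y' : A}
    (S : Sys N.m D e1 e2 x y) (S' : Sys N.m E e1' e2' x' y') : False := by
  obtain ⟨n1, l1, rfl⟩ := ev_surj S.B e1'
  obtain ⟨n2, l2, rfl⟩ := ev_surj S.B e2'
  obtain ⟨nx, lx, rfl⟩ := ev_surj S.B x'
  obtain ⟨ny, ly, rfl⟩ := ev_surj S.B y'
  have hc := (chk_iff S S'.vl l1 l2 lx ly).1 S'
  unfold sid2 at sE
  simp only [Bool.and_eq_true, Bool.or_eq_true, Nat.beq_eq] at sE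
  obtain ⟨s1, s2, s3, -⟩ := sE
  have hn1 : n1 = mulc D nx nx := by
    apply ev_inj S.B l1 (mulc_lt S.vl _ _)
    rw [← mul_ev S, S'.xx, s1, ev_1]
  have hn2 : n2 = mulc D nx n1 := by
    apply ev_inj S.B l2 (mulc_lt S.vl _ _)
    rw [← mul_ev S, S'.t1, s2, ev_2]
  unfold nos2 at hn
  have h := allB_spec hn nx lx
  simp only [frc_eq] at h
  rw [← hn1, ← hn2, Bool.or_eq_true, Nat.beq_eq] at h
  have h := allL_spec (h.resolve_left (fun h => S'.B.w2 ((InW_ev S.B l2).2 h))) E hE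
  rw [Bool.or_eq_true] at h
  rcases h with h | h
  · rw [Bool.not_eq_true', ← Bool.not_eq_true] at h
    apply h
    simp only [Nat.beq_eq, Bool.or_eq_true]
    rcases s3 with s3 | s3
    · right
      apply ev_inj S.B (mulc_lt S.vl _ _) (dblc_bd _ lx)
      rw [← mul_ev S, S'.t2, s3, ev_4, ev_dblc S.B.d1 S.B.d2 x y lx]
    · left; exact s3
  · have h := allB_spec h ny ly
    rw [hc] at h
    simp at h

theorem cross_absurd {N : NR} {D E : Dat} (sD : sid1 D = true)
    (sE : sid2 E = true) {e1 e2 x y e1' e2' x' y' : A}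
    (S : Sys N.m D e1 e2 x y) (S' : Sys N.m E e1' e2' x' y') : False := by
  unfold sid1 at sD
  simp only [Bool.and_eq_true, Nat.beq_eq] at sD
  unfold sid2 at sE
  simp only [Bool.and_eq_true, Bool.or_eq_true, Nat.beq_eq, frc_eq] at sE
  have h : N.m x x = y := by rw [S.xx, sD.1, ev_32]
  obtain ⟨n, hn, hx⟩ := ev_surj S'.B x
  have := allB_spec sE.2.2.2 n hn
  rw [Nat.beq_eq] at this
  apply S.B.dy
  rw [← h, hx, mul_ev S', ← ev_dblc S'.B.d1 S'.B.d2 x' y' (mulc_lt S'.vl _ _), this, ev_zero]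

theorem rep1 {k : Nat} (h : k < 19) : rep k = repL1.getD k zD := by
  unfold rep; rw [Nat.blt_eq.mpr h]; rfl
theorem rep2 {k : Nat} (h : ¬ k < 19) : rep k = repL2.getD (k - 19) zD := by
  unfold rep
  have : Nat.blt k 19 = false := by rw [← Bool.not_eq_true, Nat.blt_eq]; exact h
  rw [this]; rfl

theorem rep1_sid {k : Nat} (h : k < 19) : sid1 (rep k) = true := by
  rw [rep1 h]
  apply allL_spec k_sid1
  have : k < repL1.length := h
  rw [List.getD_eq_getElem _ _ this]; exact List.getElem_mem _
theorem rep2_sid {k : Nat} (h : ¬ k < 19) (h' : k < 25) : sid2 (rep k) = true := by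
  rw [rep2 h]
  apply allL_spec k_sid2
  have : k - 19 < repL2.length := by
    have : repL2.length = 6 := rfl
    omega
  rw [List.getD_eq_getElem _ _ this]; exact List.getElem_mem _

theorem HasK_lt {N : NR} {i j : Nat} (hij : i < j) (hj : j < 25) (Hi : HasK N i) (Hj : HasK N j) : False := by
  obtain ⟨a1, a2, a3, a4, S⟩ := Hi
  obtain ⟨b1, b2, b3, b4, S'⟩ := Hj
  by_cases h : j < 19
  · have h' : i < 19 := by omega
    obtain ⟨Es, h1, h2⟩ := prs_spec k_nos1 i j hij h
    rw [← rep1 h'] at h1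
    rw [← rep1 h] at h2
    exact nos1_absurd h2 h1 (rep1_sid h) S S'
  · by_cases h' : i < 19
    · exact cross_absurd (rep1_sid h') (rep2_sid h hj) S S'
    · have hl : repL2.length = 6 := rfl
      obtain ⟨Es, h1, h2⟩ := prs_spec k_nos2 (i - 19) (j - 19) (by omega) (by omega)
      rw [← rep2 h'] at h1
      rw [← rep2 h] at h2
      exact nos2_absurd h2 h1 (rep2_sid h hj) S S'

theorem HasK_unique {N : NR} {i j : Nat} (hi : i < 25) (hj : j < 25) (Hi : HasK N i) (Hj : HasK N j) :
    i = j := by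
  rcases lt_trichotomy i j with h | h | h
  · exact (HasK_lt h hj Hi Hj).elim
  · exact h
  · exact (HasK_lt h hi Hj Hi).elim

end BrC
namespace BrC

/-! ### The representatives exist -/

structure AB extends Bil where
  assoc : ∀ a b c, m (m a b) c = m a (m b c)

def Mc (_ : AB) : Type := A

def AB.c (N : AB) (a b : A) : A := a + b + N.m a b

theorem AB.c_assoc (N : AB) (a b c : A) : N.c (N.c a b) c = N.c a (N.c b c) := by
  unfold AB.c
  simp only [N.add, N.add', N.assoc]
  abel

theorem AB.c_zero_left (N : AB) (a : A) : N.c 0 a = a := by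
  unfold AB.c
  rw [N.zero', zero_add, add_zero]

theorem AB.c_zero_right (N : AB) (a : A) : N.c a 0 = a := by
  unfold AB.c
  rw [N.zero, add_zero, add_zero]

theorem AB.c_comm (N : AB) (a b : A) : N.c a b = N.c b a := by
  unfold AB.c
  rw [N.comm, add_comm a b]

instance (N : AB) : CommMonoid (Mc N) where
  mul := N.c
  one := (0 : A)
  mul_assoc := N.c_assoc
  one_mul := N.c_zero_left
  mul_one := N.c_zero_right
  mul_comm := N.c_comm

def toM (N : AB) (a : A) : Mc N := a
theorem toM_mul (N : AB) (a b : A) : toM N a * toM N b = toM N (a + b + N.m a b) := rfl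
theorem toM_zero (N : AB) : toM N 0 = 1 := rfl
theorem toM_inj (N : AB) {a b : A} (h : toM N a = toM N b) : a = b := h

theorem toM_circ {N : AB} {D : Dat} {e1 e2 x y : A} (S : Sys N.m D e1 e2 x y) {n k : Nat}
    (hn : n < 64) (hk : k < 64) :
    toM N (ev e1 e2 x y (circ D n k)) = toM N (ev e1 e2 x y n) * toM N (ev e1 e2 x y k) := by
  rw [toM_mul, mul_ev S, ← ev_addc S.B.d1 S.B.d2 x y hn hk,
    ← ev_addc S.B.d1 S.B.d2 x y (addc_lt hn hk) (mulc_lt S.vl _ _)]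
  rfl

theorem circ_lt {D : Dat} (v : Vl D) {n k : Nat} (hn : n < 64) (hk : k < 64) : circ D n k < 64 :=
  addc_lt (addc_lt hn hk) (mulc_lt v _ _)

theorem pwc_succ (D : Dat) (g i : Nat) : pwc D g (i + 1) = circ D (pwc D g i) g :=
  frc_eq (pwc D g i) (fun r => circ D r g)

theorem pwc_lt {D : Dat} (v : Vl D) {g : Nat} (hg : g < 64) (i : Nat) : pwc D g i < 64 := by
  induction i with
  | zero => show 0 < 64; norm_num
  | succ i ih => rw [pwc_succ]; exact circ_lt v ih hg

theorem toM_pwc {N : AB} {D : Dat} {e1 e2 x y : A} (S : Sys N.m D e1 e2 x y) {g : Nat}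
    (hg : g < 64) (i : Nat) :
    toM N (ev e1 e2 x y (pwc D g i)) = toM N (ev e1 e2 x y g) ^ i := by
  induction i with
  | zero => rw [pow_zero]; show toM N (ev e1 e2 x y 0) = 1; rw [ev_zero]; rfl
  | succ i ih => rw [pwc_succ, toM_circ S (pwc_lt S.vl hg i) hg, ih, pow_succ]

theorem pow_val_add {M : Type} [CommMonoid M] {n : Nat} [NeZero n] {g : M} (h : g ^ n = 1) (i j : ZMod n) :
    g ^ (i + j).val = g ^ i.val * g ^ j.val := by
  rw [ZMod.val_add, ← pow_add, ← pow_eq_pow_mod _ h]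

abbrev G := ZMod 2 × ZMod 4 × ZMod 8

theorem exists_F {N : AB} {D : Dat} {e1 e2 x y : A} (S : Sys N.m D e1 e2 x y) {g1 g2 g3 : Nat}
    (h1 : g1 < 64) (h2 : g2 < 64) (h3 : g3 < 64) (hg : grp D g1 g2 g3 = true) :
    ∃ F : G ≃ A, ∀ s t, F (s + t) = F s + F t + N.m (F s) (F t) := by
  unfold grp at hg
  simp only [Bool.and_eq_true, Nat.beq_eq] at hg
  obtain ⟨o1, o2, o3, hi⟩ := hg
  have po : ∀ {g n : Nat}, g < 64 → pwc D g n = 0 → toM N (ev e1 e2 x y g) ^ n = 1 := by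
    intro g n hg h
    rw [← toM_pwc S hg, h, ev_zero]; rfl
  have q1 := po h1 o1
  have q2 := po h2 o2
  have q3 := po h3 o3
  let F : G → Mc N := fun s => toM N (ev e1 e2 x y g1) ^ s.1.val * toM N (ev e1 e2 x y g2) ^ s.2.1.val *
    toM N (ev e1 e2 x y g3) ^ s.2.2.val
  have Fa : ∀ s t, F (s + t) = F s * F t := by
    intro s t
    show toM N (ev e1 e2 x y g1) ^ (s.1 + t.1).val * toM N (ev e1 e2 x y g2) ^ (s.2.1 + t.2.1).val *
      toM N (ev e1 e2 x y g3) ^ (s.2.2 + t.2.2).val = _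
    rw [pow_val_add q1, pow_val_add q2, pow_val_add q3]
    show _ = (toM N (ev e1 e2 x y g1) ^ s.1.val * toM N (ev e1 e2 x y g2) ^ s.2.1.val *
      toM N (ev e1 e2 x y g3) ^ s.2.2.val) * (toM N (ev e1 e2 x y g1) ^ t.1.val * toM N (ev e1 e2 x y g2) ^ t.2.1.val *
      toM N (ev e1 e2 x y g3) ^ t.2.2.val)
    simp only [mul_comm, mul_left_comm, mul_assoc]
  have F0 : F 0 = 1 := by
    show toM N (ev e1 e2 x y g1) ^ (0 : ZMod 2).val * toM N (ev e1 e2 x y g2) ^ (0 : ZMod 4).val *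
      toM N (ev e1 e2 x y g3) ^ (0 : ZMod 8).val = _
    simp only [ZMod.val_zero, pow_zero, mul_one]
  have F1 : ∀ s, F s = 1 → s = 0 := by
    intro s hs
    have a := allB_spec hi s.1.val (ZMod.val_lt s.1)
    rw [frc_eq] at a
    have a := allB_spec a s.2.1.val (ZMod.val_lt s.2.1)
    rw [frc_eq] at a
    have a := allB_spec a s.2.2.val (ZMod.val_lt s.2.2)
    rw [Bool.or_eq_true, nz_iff, Nat.beq_eq] at a
    have b1 := pwc_lt S.vl h1 s.1.val
    have b2 := pwc_lt S.vl h2 s.2.1.val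
    have b3 := pwc_lt S.vl h3 s.2.2.val
    have b12 := circ_lt S.vl b1 b2
    rcases a with a | a
    · exfalso; apply a
      apply ev_eq_zero S.B (circ_lt S.vl b12 b3)
      apply toM_inj N
      rw [toM_circ S b12 b3, toM_circ S b1 b2, toM_pwc S h1, toM_pwc S h2, toM_pwc S h3]
      exact hs
    · have a : s.1.val + (s.2.1.val + s.2.2.val) = 0 := a
      have c1 : s.1 = 0 := (ZMod.val_eq_zero _).1 (by omega)
      have c2 : s.2.1 = 0 := (ZMod.val_eq_zero _).1 (by omega)
      have c3 : s.2.2 = 0 := (ZMod.val_eq_zero _).1 (by omega)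
      exact Prod.ext c1 (Prod.ext c2 c3)
  have Fi : Function.Injective F := by
    intro s t h
    have : F (s + -t) = 1 := by rw [Fa, h, ← Fa, add_neg_cancel, F0]
    have := F1 _ this
    exact add_neg_eq_zero.mp this
  let F' : G → A := F
  have Fb : Function.Bijective F' := by
    rw [Fintype.bijective_iff_injective_and_card]
    exact ⟨Fi, by simp [ZMod.card]⟩
  exact ⟨Equiv.ofBijective F' Fb, fun s t => Fa s t⟩

theorem ev_dbl16 {c : Nat} (hc : c < 16) {e1 e2 : A} (h1 : e1 + e1 = 0) (h2 : e2 + e2 = 0) (x y : A) :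
    ev e1 e2 x y c + ev e1 e2 x y c = 0 := by
  have : ∀ c < 16, dblc c = 0 := by decide
  rw [← ev_dblc h1 h2 x y (by omega), this c hc, ev_zero]

theorem ev_dblV {a b c d : A} (h1 : a + a = 0) (h2 : b + b = 0) (h3 : c + c = 0) (h4 : d + d = 0) (n : Nat) :
    ev a b c d n + ev a b c d n = 0 := by
  unfold ev
  calc _ = tb n 0 • (a + a) + tb n 1 • (b + b) + cx n • (c + c) + cy n • (d + d) := by module
    _ = 0 := by rw [h1, h2, h3, h4]; simp

theorem ev_comm (a b c d e f g h i j : A) (n k : Nat) :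
    ev (ev a b d f k) (ev b c e g k) (ev d e h i k) (ev f g i j k) n =
    ev (ev a b d f n) (ev b c e g n) (ev d e h i n) (ev f g i j n) k := by
  unfold ev
  module

theorem zero_ext {e1 e2 x y : A} (B : Bas e1 e2 x y) {f g : A → A} (hf : ∀ a b, f (a + b) = f a + f b)
    (hg : ∀ a b, g (a + b) = g a + g b)
    (h1 : f e1 = g e1) (h2 : f e2 = g e2) (hx : f x = g x) (hy : f y = g y) (a : A) : f a = g a := by
  obtain ⟨n, hn, rfl⟩ := ev_surj B a
  rw [map_ev f hf, map_ev g hg, h1, h2, hx, hy]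

theorem exists_Bil {D : Dat} (hD : vld D = true) {e1 e2 x y : A} (B : Bas e1 e2 x y) :
    ∃ N : Bil, Sys N.m D e1 e2 x y := by
  obtain ⟨v, l1, l2, l3, l4, l5, l6, l7⟩ := vld_spec hD
  obtain ⟨cod, hcod⟩ : ∃ cod : A → Nat, ∀ a, cod a < 64 ∧ a = ev e1 e2 x y (cod a) :=
    ⟨fun a => (ev_surj B a).choose, fun a => (ev_surj B a).choose_spec⟩
  have c' : ∀ n < 64, cod (ev e1 e2 x y n) = n := fun n hn =>
    ev_inj B (hcod _).1 hn (hcod _).2.symm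
  have cadd : ∀ a b, cod (a + b) = addc (cod a) (cod b) := by
    intro a b
    apply ev_inj B (hcod _).1 (addc_lt (hcod _).1 (hcod _).1)
    rw [ev_addc B.d1 B.d2 x y (hcod _).1 (hcod _).1, ← (hcod _).2, ← (hcod _).2, ← (hcod _).2]
  have z11 := ev_dbl16 l1 B.d1 B.d2 x y
  have z12 := ev_dbl16 l2 B.d1 B.d2 x y
  have z22 := ev_dbl16 l3 B.d1 B.d2 x y
  have zt1 := ev_dbl16 l4 B.d1 B.d2 x y
  have zt2 := ev_dbl16 l5 B.d1 B.d2 x y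
  have zs1 := ev_dbl16 l6 B.d1 B.d2 x y
  have zs2 := ev_dbl16 l7 B.d1 B.d2 x y
  generalize hp11 : ev e1 e2 x y D.p11 = p11 at *
  generalize hp12 : ev e1 e2 x y D.p12 = p12 at *
  generalize hp22 : ev e1 e2 x y D.p22 = p22 at *
  generalize ht1 : ev e1 e2 x y D.t1 = t1 at *
  generalize ht2 : ev e1 e2 x y D.t2 = t2 at *
  generalize hs1 : ev e1 e2 x y D.s1 = s1 at *
  generalize hs2 : ev e1 e2 x y D.s2 = s2 at *
  generalize hxx : ev e1 e2 x y D.xx = xx at *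
  generalize hxy : ev e1 e2 x y D.xy = xy at *
  generalize hyy : ev e1 e2 x y D.yy = yy at *
  let M : Nat → Nat → A := fun n k => ev (ev p11 p12 t1 s1 k) (ev p12 p22 t2 s2 k) (ev t1 t2 xx xy k)
    (ev s1 s2 xy yy k) n
  have Mc : ∀ n k, M n k = M k n := fun n k => ev_comm _ _ _ _ _ _ _ _ _ _ n k
  have Ma : ∀ n n' k, n < 64 → n' < 64 → M (addc n n') k = M n k + M n' k := by
    intro n n' k hn hn'
    exact ev_addc (ev_dblV z11 z12 zt1 zs1 k) (ev_dblV z12 z22 zt2 zs2 k) _ _ hn hn'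
  have k1 : cod e1 = 1 := by conv_lhs => rw [← ev_1 e1 e2 x y]
                             exact c' 1 (by norm_num)
  have k2 : cod e2 = 2 := by conv_lhs => rw [← ev_2 e1 e2 x y]
                             exact c' 2 (by norm_num)
  have kx : cod x = 16 := by conv_lhs => rw [← ev_16 e1 e2 x y]
                             exact c' 16 (by norm_num)
  have ky : cod y = 32 := by conv_lhs => rw [← ev_32 e1 e2 x y]
                             exact c' 32 (by norm_num)
  refine ⟨⟨fun a b => M (cod a) (cod b), fun a b => Mc _ _, ?_⟩, B, v, ?_, ?_, ?_, ?_, ?_, ?_, ?_, ?_, ?_, ?_⟩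
  · intro a b c
    show M (cod a) (cod (b + c)) = M (cod a) (cod b) + M (cod a) (cod c)
    rw [cadd, Mc, Ma _ _ _ (hcod _).1 (hcod _).1, Mc, Mc (cod c)]
  all_goals
    simp only [M, k1, k2, kx, ky, ev_1, ev_2, ev_16, ev_32, hp11, hp12, hp22, ht1, ht2, hs1, hs2, hxx, hxy, hyy]

theorem gen_lt : ∀ k < 25, gen1 k < 64 ∧ gen2 k < 64 := by decide +kernel

theorem exists_model {k : Nat} (hk : k < 25) : ∃ (L : LeftBrace (Fin 64)) (N : NR), L.AddIso A ∧ L.MulIso G ∧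
    Rp L N ∧ HasK N k := by
  have h := mdl_spec hk
  unfold mdl at h
  rw [Bool.and_eq_true, Bool.and_eq_true] at h
  obtain ⟨hv, hg, ha⟩ := h
  have B := stdBas
  obtain ⟨N0, S⟩ := exists_Bil hv B
  set e1 : A := (1, 0, 0, 0)
  set e2 : A := (0, 1, 0, 0)
  set x : A := (0, 0, 1, 0)
  set y : A := (0, 0, 0, 1)
  have ga : ∀ a b c, asc1 (rep k) a b c = true → N0.m (N0.m (ev e1 e2 x y a) (ev e1 e2 x y b)) (ev e1 e2 x y c) =
      N0.m (ev e1 e2 x y a) (N0.m (ev e1 e2 x y b) (ev e1 e2 x y c)) := by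
    intro a b c h
    unfold asc1 at h
    rw [Nat.beq_eq] at h
    rw [mul_ev S, mul_ev S, mul_ev S, mul_ev S, h]
  have all4_spec : ∀ {f : Nat → Bool}, all4 f = true → f 1 = true ∧ f 2 = true ∧ f 16 = true ∧ f 32 = true := by
    intro f h
    unfold all4 at h
    simpa only [Bool.and_eq_true] using h
  have st1 : ∀ a b, (all4 fun c => asc1 (rep k) a b c) = true → ∀ c, N0.m (N0.m (ev e1 e2 x y a) (ev e1 e2 x y b)) c =
      N0.m (ev e1 e2 x y a) (N0.m (ev e1 e2 x y b) c) := by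
    intro a b h
    obtain ⟨h1, h2, h3, h4⟩ := all4_spec h
    have h1 := ga _ _ _ h1
    have h2 := ga _ _ _ h2
    have h3 := ga _ _ _ h3
    have h4 := ga _ _ _ h4
    rw [ev_1 e1 e2 x y] at h1
    rw [ev_2 e1 e2 x y] at h2
    rw [ev_16 e1 e2 x y] at h3
    rw [ev_32 e1 e2 x y] at h4
    exact zero_ext (f := fun c => N0.m (N0.m (ev e1 e2 x y a) (ev e1 e2 x y b)) c)
      (g := fun c => N0.m (ev e1 e2 x y a) (N0.m (ev e1 e2 x y b) c)) B
      (fun u v => N0.add _ _ _) (fun u v => by simp only [N0.add]) h1 h2 h3 h4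
  have st2 : ∀ a, (all4 fun b => all4 fun c => asc1 (rep k) a b c) = true → ∀ c b, N0.m (N0.m (ev e1 e2 x y a) b) c =
      N0.m (ev e1 e2 x y a) (N0.m b c) := by
    intro a h c
    obtain ⟨h1, h2, h3, h4⟩ := all4_spec h
    have h1 := st1 _ _ h1 c
    have h2 := st1 _ _ h2 c
    have h3 := st1 _ _ h3 c
    have h4 := st1 _ _ h4 c
    rw [ev_1 e1 e2 x y] at h1
    rw [ev_2 e1 e2 x y] at h2
    rw [ev_16 e1 e2 x y] at h3
    rw [ev_32 e1 e2 x y] at h4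
    exact zero_ext (f := fun b => N0.m (N0.m (ev e1 e2 x y a) b) c)
      (g := fun b => N0.m (ev e1 e2 x y a) (N0.m b c)) B
      (fun u v => by simp only [N0.add, N0.add']) (fun u v => by simp only [N0.add, N0.add']) h1 h2 h3 h4
  have st3 : ∀ c b a, N0.m (N0.m a b) c = N0.m a (N0.m b c) := by
    intro c b
    obtain ⟨h1, h2, h3, h4⟩ := all4_spec ha
    have h1 := st2 _ h1 c b
    have h2 := st2 _ h2 c b
    have h3 := st2 _ h3 c b
    have h4 := st2 _ h4 c b
    rw [ev_1 e1 e2 x y] at h1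
    rw [ev_2 e1 e2 x y] at h2
    rw [ev_16 e1 e2 x y] at h3
    rw [ev_32 e1 e2 x y] at h4
    exact zero_ext (f := fun a => N0.m (N0.m a b) c)
      (g := fun a => N0.m a (N0.m b c)) B
      (fun u v => by simp only [N0.add']) (fun u v => by simp only [N0.add']) h1 h2 h3 h4
  let N : AB := ⟨N0, fun a b c => st3 c b a⟩
  obtain ⟨F, hF⟩ := exists_F (N := N) S (gen_lt k hk).1 (gen_lt k hk).2 (show 16 < 64 by norm_num) hg
  have hF : ∀ s t, F (s + t) = F s + F t + N0.m (F s) (F t) := hF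
  have hF' : ∀ a b, a + b + N0.m a b = F (F.symm a + F.symm b) := by
    intro a b; rw [hF]; simp only [Equiv.apply_symm_apply]
  have F0 : F 0 = 0 := by
    have e := hF' (F 0) 0
    rw [N0.zero, Equiv.symm_apply_apply, zero_add, Equiv.apply_symm_apply] at e
    simpa using e
  let E : Fin 64 ≃ A := Equiv.ofBijective _ (ev_bij B)
  let L : LeftBrace (Fin 64) :=
    { add := fun a b => E.symm (E a + E b)
      zero := E.symm 0
      neg := fun a => E.symm (-(E a))
      mul := fun a b => E.symm (E a + E b + N0.m (E a) (E b))
      one := E.symm 0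
      inv := fun a => E.symm (F (- F.symm (E a)))
      add_assoc := by intro a b c; simp only [Equiv.apply_symm_apply, add_assoc]
      add_comm := by intro a b; rw [add_comm]
      zero_add := by intro a; simp only [Equiv.apply_symm_apply, zero_add, Equiv.symm_apply_apply]
      neg_add_cancel := by intro a; simp only [Equiv.apply_symm_apply, neg_add_cancel]
      mul_assoc := by
        intro a b c
        simp only [Equiv.apply_symm_apply, hF', Equiv.symm_apply_apply, add_assoc]
      one_mul := by
        intro a
        simp only [Equiv.apply_symm_apply, N0.zero', zero_add, add_zero, Equiv.symm_apply_apply]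
      mul_one := by
        intro a
        simp only [Equiv.apply_symm_apply, N0.zero, add_zero, Equiv.symm_apply_apply]
      inv_mul_cancel := by
        intro a
        simp only [Equiv.apply_symm_apply, hF', Equiv.symm_apply_apply, neg_add_cancel, F0]
      brace := by
        intro a b c
        simp only [Equiv.apply_symm_apply, N0.add]
        congr 1; abel }
  have quasi : ∀ c, ∃ c', c + c' + N0.m c c' = 0 := by
    intro c
    refine ⟨F (- F.symm c), ?_⟩
    rw [hF', Equiv.symm_apply_apply, add_neg_cancel, F0]
  refine ⟨L, ⟨N0, N.assoc, quasi⟩, ⟨E, fun a b => E.apply_symm_apply _⟩, ⟨E.trans F.symm, ?_⟩,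
    ⟨E, fun a b => E.apply_symm_apply _, fun a b => E.apply_symm_apply _⟩, ⟨e1, e2, x, y, S⟩⟩
  intro a b
  show F.symm (E (E.symm (E a + E b + N0.m (E a) (E b)))) = F.symm (E a) + F.symm (E b)
  rw [E.apply_symm_apply, hF', Equiv.symm_apply_apply]

theorem main_card :
    Nat.card (Quot (fun (L₁ L₂ : {L : LeftBrace (Fin 64) //
        L.AddIso A ∧ L.MulIso G}) => L₁.1.Iso L₂.1)) = 25 := by
  set X := {L : LeftBrace (Fin 64) // L.AddIso A ∧ L.MulIso G}
  have ex : ∀ L : X, ∃ k : Fin 25, ∃ N, Rp L.1 N ∧ HasK N k.1 := by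
    intro L
    obtain ⟨N, R, Gd⟩ := exists_NR L.1 L.2.1 L.2.2
    obtain ⟨k, hk, H⟩ := exists_k Gd
    exact ⟨⟨k, hk⟩, N, R, H⟩
  choose g hg using ex
  have uniq : ∀ (L : X) (k : Fin 25) (N : NR), Rp L.1 N → HasK N k.1 → g L = k := by
    intro L k N R H
    obtain ⟨N', R', H'⟩ := hg L
    exact Fin.ext (HasK_unique (g L).2 k.2 H' (HasK_transport R' R H))
  have lift : ∀ L₁ L₂ : X, L₁.1.Iso L₂.1 → g L₁ = g L₂ := by
    intro L₁ L₂ h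
    obtain ⟨N, R, H⟩ := hg L₂
    exact uniq L₁ _ N (Rp_iso h R) H
  have bij : Function.Bijective (Quot.lift g lift) := by
    constructor
    · intro a b
      induction a using Quot.ind with | _ L₁ =>
      induction b using Quot.ind with | _ L₂ =>
      intro h
      have h : g L₁ = g L₂ := h
      apply Quot.sound
      obtain ⟨N, R, H⟩ := hg L₁
      obtain ⟨N', R', H'⟩ := hg L₂
      rw [← h] at H'
      obtain ⟨_, _, _, _, S⟩ := H
      obtain ⟨_, _, _, _, S'⟩ := H'
      exact iso_of_sys R R' S S'
    · intro k
      obtain ⟨L, N, h1, h2, R, H⟩ := exists_model k.2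
      exact ⟨Quot.mk _ ⟨L, h1, h2⟩, uniq ⟨L, h1, h2⟩ k N R H⟩
  rw [Nat.card_congr (Equiv.ofBijective _ bij), Nat.card_fin]

end BrC
/-- The number of isomorphism classes of left braces with additive group
isomorphic to `C₂ × C₂ × C₄ × C₄` and multiplicative group isomorphic to
`C₂ × C₄ × C₈` is `25`. -/
theorem number_of_braces_by_mul_group :
    Nat.card (Quot (fun (L₁ L₂ : {L : LeftBrace (Fin 64) //
        L.AddIso (ZMod 2 × ZMod 2 × ZMod 4 × ZMod 4) ∧
        L.MulIso (ZMod 2 × ZMod 4 × ZMod 8)}) => L₁.1.Iso L₂.1)) = 25 := by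
  exact BrC.main_card
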